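/- arXiv:1507.04917 — 3 statements merged into one kernel-verified Lean document; each statement's English description precedes it below -/
import Mathlib

section
/- Let d and s be positive integers with ds even. Then for all sufficiently large primes p: H_{p−1}({s}^d) ≡ (−1)^{d−1} · s · (B_{p−ds−1}/(ds+1)) · p (mod p²), where {s}^d denotes s repeated d times. -/
open scoped BigOperators

/-- Alternating multiple harmonic sum `H_n(𝐬)` where `𝐬` is a list of pairs
`(sⱼ, εⱼ)` (exponent, sign):
`H_n(𝐬) = Σ_{n ≥ k₁ > ⋯ > k_d ≥ 1} Π εⱼ^{kⱼ} / kⱼ^{sⱼ}`. -/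
def AMHS : ℕ → List (ℕ × ℚ) → ℚ
  | _, [] => 1
  | n, (s, ε) :: t => ∑ k ∈ Finset.Icc 1 n, ε ^ k / (k : ℚ) ^ s * AMHS (k - 1) t

/-- Alternating multiple harmonic star sum `H⋆_n(𝐬)` (indices weakly decreasing). -/
def AMHSstar : ℕ → List (ℕ × ℚ) → ℚ
  | _, [] => 1
  | n, (s, ε) :: t => ∑ k ∈ Finset.Icc 1 n, ε ^ k / (k : ℚ) ^ s * AMHSstar k t

/-- A list of pairs is a signed composition: positive exponents, signs `±1`. -/
def IsSignedComp (l : List (ℕ × ℚ)) : Prop := ∀ x ∈ l, 0 < x.1 ∧ (x.2 = 1 ∨ x.2 = -1)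

/-- `a ≡ b (mod p^ℓ)` for rationals: the `p`-adic valuation of `a - b` is at least `ℓ`. -/
def RatModEq (p ℓ : ℕ) (a b : ℚ) : Prop := a = b ∨ (ℓ : ℤ) ≤ padicValRat p (a - b)

/-- View a composition of positive integers as a signed composition with all signs `+1`. -/
def posComp (l : List ℕ) : List (ℕ × ℚ) := l.map (fun s => (s, 1))

/-- `x` is divisible by `p ^ j` in the ring of `p`-integral rationals. -/
def PDvd (p j : ℕ) (x : ℚ) : Prop := padicNorm p x ≤ ((p : ℚ) ^ j)⁻¹

section basics
set_option linter.unusedSectionVars false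
variable {p : ℕ} [hp : Fact p.Prime]

lemma PDvd.zero (j : ℕ) : PDvd p j 0 := by
  unfold PDvd; simp

lemma PDvd.neg {j : ℕ} {x : ℚ} (hx : PDvd p j x) : PDvd p j (-x) := by
  unfold PDvd at *; simpa using hx

lemma PDvd.add {j : ℕ} {x y : ℚ} (hx : PDvd p j x) (hy : PDvd p j y) : PDvd p j (x + y) :=
  le_trans padicNorm.nonarchimedean (max_le hx hy)

lemma PDvd.sub {j : ℕ} {x y : ℚ} (hx : PDvd p j x) (hy : PDvd p j y) : PDvd p j (x - y) := by
  rw [sub_eq_add_neg]; exact hx.add hy.neg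

lemma PDvd.sum {ι : Type*} {j : ℕ} {f : ι → ℚ} {t : Finset ι} (h : ∀ i ∈ t, PDvd p j (f i)) :
    PDvd p j (∑ i ∈ t, f i) :=
  Finset.sum_induction f (PDvd p j) (fun _ _ => PDvd.add) (PDvd.zero j) h

lemma PDvd.mul {i j : ℕ} {x y : ℚ} (hx : PDvd p i x) (hy : PDvd p j y) :
    PDvd p (i + j) (x * y) := by
  unfold PDvd at *
  rw [padicNorm.mul, pow_add, mul_inv]
  exact mul_le_mul hx hy (padicNorm.nonneg _) (by positivity)

lemma PDvd.mul_left {j : ℕ} {x y : ℚ} (hx : PDvd p 0 x) (hy : PDvd p j y) : PDvd p j (x * y) := by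
  simpa using hx.mul hy

lemma PDvd.mul_right {j : ℕ} {x y : ℚ} (hx : PDvd p j x) (hy : PDvd p 0 y) : PDvd p j (x * y) :=
  hx.mul hy

lemma PDvd.mono {i j : ℕ} {x : ℚ} (h : i ≤ j) (hx : PDvd p j x) : PDvd p i x := by
  unfold PDvd at *
  refine hx.trans ?_
  have h1 : (1 : ℚ) ≤ p := by exact_mod_cast hp.out.one_lt.le
  gcongr

lemma PDvd.natCast (n : ℕ) : PDvd p 0 (n : ℚ) := by
  unfold PDvd; simpa using padicNorm.of_nat (p := p) n

lemma PDvd.intCast (n : ℤ) : PDvd p 0 (n : ℚ) := by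
  unfold PDvd; simpa using padicNorm.of_int (p := p) n

lemma PDvd.one : PDvd p 0 (1 : ℚ) := by
  simpa using PDvd.natCast (p := p) 1

lemma PDvd.pow {x : ℚ} (hx : PDvd p 0 x) (n : ℕ) : PDvd p 0 (x ^ n) := by
  induction n with
  | zero => simpa using PDvd.one
  | succ n ih => rw [pow_succ]; exact ih.mul_left hx

lemma PDvd.ppow (n : ℕ) : PDvd p n ((p : ℚ) ^ n) := by
  unfold PDvd
  have : padicNorm p ((p : ℚ) ^ n) = (padicNorm p p) ^ n := by
    induction n with
    | zero => simp
    | succ n ih => rw [pow_succ, padicNorm.mul, ih, pow_succ]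
  rw [this, padicNorm.padicNorm_p_of_prime, inv_pow]

lemma PDvd.self : PDvd p 1 (p : ℚ) := by simpa using PDvd.ppow (p := p) 1

lemma PDvd.of_int_dvd {z : ℤ} (h : (p : ℤ) ∣ z) : PDvd p 1 (z : ℚ) := by
  obtain ⟨c, rfl⟩ := h
  push_cast
  exact PDvd.self.mul_right (PDvd.intCast c)

lemma PDvd.inv {n : ℕ} (h : ¬ p ∣ n) : PDvd p 0 ((n : ℚ)⁻¹) := by
  unfold PDvd
  rw [← one_div, padicNorm.div, (padicNorm.nat_eq_one_iff n).2 h]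
  simp

lemma PDvd.inv_lt {n : ℕ} (h0 : 0 < n) (h : n < p) : PDvd p 0 ((n : ℚ)⁻¹) :=
  PDvd.inv (Nat.not_dvd_of_pos_of_lt h0 h)

lemma PDvd.of_mul {j n : ℕ} {x : ℚ} (h0 : 0 < n) (h : n < p) (hx : PDvd p j (n * x)) :
    PDvd p j x := by
  have h1 : x = (n : ℚ)⁻¹ * (n * x) := by field_simp
  rw [h1]
  exact (PDvd.inv_lt h0 h).mul_left hx

lemma PDvd.div_p {j : ℕ} {x : ℚ} (hx : PDvd p (j + 1) x) : PDvd p j (x / p) := by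
  unfold PDvd at *
  have h1 : (0 : ℚ) < p := by exact_mod_cast hp.out.pos
  rw [padicNorm.div, padicNorm.padicNorm_p_of_prime, div_inv_eq_mul]
  calc padicNorm p x * p ≤ ((p : ℚ) ^ (j + 1))⁻¹ * p := by gcongr
    _ = _ := by rw [pow_succ]; field_simp

lemma PDvd.ratModEq {j : ℕ} {a b : ℚ} (h : PDvd p j (a - b)) : RatModEq p j a b := by
  by_cases hab : a = b
  · exact Or.inl hab
  · right
    unfold PDvd at h
    rw [padicNorm.eq_zpow_of_nonzero (sub_ne_zero.2 hab), ← zpow_natCast, ← zpow_neg] at h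
    have := (zpow_le_zpow_iff_right₀ (a := (p : ℚ)) (by exact_mod_cast hp.out.one_lt)).1 h
    omega

/-- Power sums mod `p`. -/
lemma sum_pow_mod (e : ℕ) :
    PDvd p 1 (∑ k ∈ Finset.Icc 1 (p - 1), (k : ℚ) ^ e + if p - 1 ∣ e then 1 else 0) := by
  have key : ((∑ k ∈ Finset.Icc 1 (p - 1), (k : ℤ) ^ e + if p - 1 ∣ e then 1 else 0 : ℤ) : ZMod p)
      = 0 := by
    have h := FiniteField.sum_pow_units (ZMod p) e
    rw [ZMod.card] at h
    have h2 : (∑ k ∈ Finset.Icc 1 (p - 1), (k : ZMod p) ^ e) = ∑ x : (ZMod p)ˣ, (x ^ e : ZMod p) := by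
      symm
      refine Finset.sum_bij (fun x _ => (x : ZMod p).val) ?_ ?_ ?_ ?_
      · intro x _
        have h1 := ZMod.val_lt (x : ZMod p)
        have h0 : (x : ZMod p).val ≠ 0 := by
          rw [Ne, ZMod.val_eq_zero]; exact x.ne_zero
        rw [Finset.mem_Icc]; omega
      · intro x _ y _ hxy
        exact Units.ext (ZMod.val_injective p hxy)
      · intro k hk
        rw [Finset.mem_Icc] at hk
        have hpp := hp.out.pos
        have hk0 : (k : ZMod p) ≠ 0 := by
          rw [Ne, ZMod.natCast_eq_zero_iff]
          exact Nat.not_dvd_of_pos_of_lt (by omega) (by omega)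
        refine ⟨Units.mk0 _ hk0, Finset.mem_univ _, ?_⟩
        simp only [Units.val_mk0]
        exact ZMod.val_cast_of_lt (by omega)
      · intro x _
        simp
    push_cast
    rw [h2, h]
    split_ifs <;> simp
  have := PDvd.of_int_dvd (p := p) ((ZMod.intCast_zmod_eq_zero_iff_dvd _ p).1 key)
  push_cast at this
  exact this

lemma sum_pow_mod_zero {e : ℕ} (h : ¬ p - 1 ∣ e) :
    PDvd p 1 (∑ k ∈ Finset.Icc 1 (p - 1), (k : ℚ) ^ e) := by
  have := sum_pow_mod (p := p) e
  simpa [h] using this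

/-- Fermat. -/
lemma fermat_mod {k : ℕ} (hk : k ∈ Finset.Icc 1 (p - 1)) : PDvd p 1 ((k : ℚ) ^ (p - 1) - 1) := by
  rw [Finset.mem_Icc] at hk
  have hpp := hp.out.pos
  have hk0 : (k : ZMod p) ≠ 0 := by
    rw [Ne, ZMod.natCast_eq_zero_iff]
    exact Nat.not_dvd_of_pos_of_lt (by omega) (by omega)
  have key : (((k : ℤ) ^ (p - 1) - 1 : ℤ) : ZMod p) = 0 := by
    push_cast
    rw [ZMod.pow_card_sub_one_eq_one hk0, sub_self]
  have := PDvd.of_int_dvd (p := p) ((ZMod.intCast_zmod_eq_zero_iff_dvd _ p).1 key)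
  push_cast at this
  exact this

lemma bernoulli_int {n : ℕ} (h : n + 1 < p) : PDvd p 0 (bernoulli n) := by
  induction n using Nat.strong_induction_on with
  | _ n ih =>
    have hs := sum_bernoulli (n + 1)
    rw [Finset.sum_range_succ] at hs
    have h1 : ((n + 1 : ℕ) : ℚ) * bernoulli n = (if n + 1 = 1 then 1 else 0) -
        ∑ k ∈ Finset.range n, ((n + 1).choose k : ℚ) * bernoulli k := by
      rw [← hs]; simp
    refine PDvd.of_mul (Nat.succ_pos n) h ?_
    rw [h1]
    refine PDvd.sub ?_ (PDvd.sum fun k hk => ?_)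
    · split_ifs
      · exact PDvd.one
      · exact PDvd.zero 0
    · rw [Finset.mem_range] at hk
      exact (PDvd.natCast _).mul_left (ih k hk (by omega))

lemma range_eq_Icc (f : ℕ → ℚ) (h0 : f 0 = 0) :
    ∑ k ∈ Finset.range p, f k = ∑ k ∈ Finset.Icc 1 (p - 1), f k := by
  have hpp := hp.out.pos
  symm
  refine Finset.sum_subset ?_ ?_
  · intro k hk
    rw [Finset.mem_Icc] at hk
    rw [Finset.mem_range]; omega
  · intro k hk hk'
    rw [Finset.mem_Icc] at hk'
    rw [Finset.mem_range] at hk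
    have : k = 0 := by omega
    rw [this, h0]

/-- `∑ k^n ≡ p B_n (mod p²)`. -/
lemma sum_pow_sq {n : ℕ} (h0 : 0 < n) (h : n + 1 < p) :
    PDvd p 2 (∑ k ∈ Finset.Icc 1 (p - 1), (k : ℚ) ^ n - p * bernoulli n) := by
  rw [← range_eq_Icc _ (by simp [h0.ne']), sum_range_pow, Finset.sum_range_succ]
  have h1 : bernoulli n * ((n + 1).choose n : ℚ) * (p : ℚ) ^ (n + 1 - n) / (n + 1)
      = p * bernoulli n := by
    have : ((n : ℚ) + 1) ≠ 0 := by positivity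
    simp
    field_simp
  rw [h1, add_sub_cancel_right]
  refine PDvd.sum fun i hi => ?_
  rw [Finset.mem_range] at hi
  rw [div_eq_mul_inv]
  have h2 := PDvd.inv_lt (p := p) (Nat.succ_pos n) h
  push_cast at h2
  refine PDvd.mul_right (PDvd.mul_left ?_ ?_) h2
  · exact (bernoulli_int (by omega)).mul_left (PDvd.natCast _)
  · exact (PDvd.ppow (p := p) (n + 1 - i)).mono (by omega)

lemma choose_mod (j : ℕ) (hj : j < p) : PDvd p 1 (((p - 1).choose j : ℚ) - (-1) ^ j) := by
  induction j with
  | zero => simpa using PDvd.zero 1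
  | succ j ih =>
    have h1 : p.choose (j + 1) = (p - 1).choose j + (p - 1).choose (j + 1) := by
      conv_lhs => rw [show p = (p - 1) + 1 from by omega]
      rw [Nat.choose_succ_succ]
    have h2 : PDvd p 1 ((p.choose (j + 1) : ℕ) : ℚ) := by
      have := PDvd.of_int_dvd (p := p) (z := (p.choose (j + 1) : ℕ))
        (by exact_mod_cast hp.out.dvd_choose_self (Nat.succ_ne_zero j) hj)
      simpa using this
    have h3 := h2.sub (ih (by omega))
    rw [h1] at h3
    push_cast at h3
    convert h3 using 1
    ring


lemma faulhaber_quot (r k : ℕ) (hr : 0 < r) :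
    ((k : ℚ) ^ (r + 1) - k) / (r + 1) = ∑ i ∈ Finset.range k, (i : ℚ) ^ r -
      ∑ t ∈ Finset.Ico 1 r, ((r + 1).choose t : ℚ) / (r + 1) * bernoulli t *
        ((k : ℚ) ^ (r + 1 - t) - k) := by
  have h1 := sum_range_pow k r
  have h2 := sum_range_pow 1 r
  simp only [Finset.sum_range_one, Nat.cast_zero, zero_pow hr.ne', Nat.cast_one, one_pow,
    mul_one] at h2
  have h3 : ∑ i ∈ Finset.range k, (i : ℚ) ^ r = ∑ t ∈ Finset.range (r + 1),
      ((r + 1).choose t : ℚ) / (r + 1) * bernoulli t * ((k : ℚ) ^ (r + 1 - t) - k) := by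
    have h4 : ∑ i ∈ Finset.range k, (i : ℚ) ^ r = ∑ i ∈ Finset.range k, (i : ℚ) ^ r - k * 0 := by
      ring
    rw [h4, h2, h1, Finset.mul_sum, ← Finset.sum_sub_distrib]
    refine Finset.sum_congr rfl fun t _ => ?_
    ring
  have h5 : ∑ t ∈ Finset.range (r + 1),
      ((r + 1).choose t : ℚ) / (r + 1) * bernoulli t * ((k : ℚ) ^ (r + 1 - t) - k) =
      ((k : ℚ) ^ (r + 1) - k) / (r + 1) + ∑ t ∈ Finset.Ico 1 r,
        ((r + 1).choose t : ℚ) / (r + 1) * bernoulli t * ((k : ℚ) ^ (r + 1 - t) - k) := by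
    rw [Finset.sum_range_succ, Finset.range_eq_Ico, Finset.sum_eq_sum_Ico_succ_bot hr]
    simp
    ring
  rw [h3, h5]; ring

lemma choose_div_mod {t : ℕ} (h0 : 0 < t) (h : t < p) :
    PDvd p 1 ((p.choose t : ℚ) / p + (-1) ^ t / t) := by
  have hpp := hp.out.pos
  have hp0 : (p : ℚ) ≠ 0 := by exact_mod_cast hpp.ne'
  refine PDvd.of_mul h0 h ?_
  obtain ⟨t, rfl⟩ := Nat.exists_eq_succ_of_ne_zero h0.ne'
  have h1 := Nat.add_one_mul_choose_eq (p - 1) t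
  rw [Nat.sub_add_cancel hpp] at h1
  have h2 : (p : ℚ) * (p - 1).choose t = p.choose (t + 1) * (t + 1) := by exact_mod_cast h1
  have h3 := choose_mod (p := p) t (by omega)
  convert h3 using 1
  have ht : ((t : ℚ) + 1) ≠ 0 := by positivity
  push_cast
  field_simp
  rw [Nat.succ_eq_add_one]
  linear_combination -h2

lemma choose_div_int {t : ℕ} (h0 : 0 < t) (h : t < p) : PDvd p 0 ((p.choose t : ℚ) / p) := by
  have h1 := (choose_div_mod h0 h).mono (Nat.zero_le 1)
  have h2 : PDvd p 0 ((-1 : ℚ) ^ t * (t : ℚ)⁻¹) :=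
    (PDvd.one.neg.pow t).mul_left (PDvd.inv_lt h0 h)
  convert h1.sub h2 using 1
  ring

/-- `∑ k^n q_p(k) ≡ -B_n / n (mod p)`. -/
lemma sum_pow_quot {n : ℕ} (hn : 2 ≤ n) (hev : Even n) (h : n + 1 < p) :
    PDvd p 1 (∑ k ∈ Finset.Icc 1 (p - 1), (k : ℚ) ^ n * (((k : ℚ) ^ (p - 1) - 1) / p)
      + bernoulli n / n) := by
  have hpp := hp.out.pos
  have hnd : ∀ e, 0 < e → e < p - 1 → ¬ p - 1 ∣ e :=
    fun e h0 h1 => Nat.not_dvd_of_pos_of_lt h0 h1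
  have hterm : ∀ k ∈ Finset.Icc 1 (p - 1), (k : ℚ) ^ n * (((k : ℚ) ^ (p - 1) - 1) / p) =
      (k : ℚ) ^ (n - 1) * ∑ i ∈ Finset.range k, (i : ℚ) ^ (p - 1) -
      ∑ t ∈ Finset.Ico 1 (p - 1), (p.choose t : ℚ) / p * bernoulli t *
        ((k : ℚ) ^ (n - 1 + (p - t)) - (k : ℚ) ^ n) := by
    intro k hk
    have h1 := faulhaber_quot (p - 1) k (by omega)
    have h2 : ((p - 1 : ℕ) : ℚ) + 1 = p := by
      have : p - 1 + 1 = p := by omega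
      exact_mod_cast this
    rw [h2, Nat.sub_add_cancel hpp] at h1
    have h3 : (k : ℚ) ^ n = (k : ℚ) ^ (n - 1) * k := by
      rw [← pow_succ]; congr 1; omega
    have h4 : (k : ℚ) ^ p = (k : ℚ) ^ (p - 1) * k := by
      rw [← pow_succ]; congr 1; omega
    have h5 : (k : ℚ) ^ n * (((k : ℚ) ^ (p - 1) - 1) / p) =
        (k : ℚ) ^ (n - 1) * (((k : ℚ) ^ p - k) / p) := by
      rw [h3, h4]; ring
    rw [h5, h1, mul_sub, Finset.mul_sum (Finset.Ico 1 (p - 1))]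
    congr 1
    refine Finset.sum_congr rfl fun t _ => ?_
    rw [pow_add, h3]
    ring
  rw [Finset.sum_congr rfl hterm, Finset.sum_sub_distrib, Finset.sum_comm (s := Finset.Icc 1 (p - 1))
    (t := Finset.Ico 1 (p - 1))]
  -- first piece
  have hA : PDvd p 1 (∑ k ∈ Finset.Icc 1 (p - 1),
      (k : ℚ) ^ (n - 1) * ∑ i ∈ Finset.range k, (i : ℚ) ^ (p - 1)) := by
    have h1 : ∀ k ∈ Finset.Icc 1 (p - 1), PDvd p 1 ((k : ℚ) ^ (n - 1) *
        ∑ i ∈ Finset.range k, (i : ℚ) ^ (p - 1) - ((k : ℚ) ^ n - (k : ℚ) ^ (n - 1))) := by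
      intro k hk
      rw [Finset.mem_Icc] at hk
      have h3 : (k : ℚ) ^ n = (k : ℚ) ^ (n - 1) * k := by
        rw [← pow_succ]; congr 1; omega
      have h4 : ∑ i ∈ Finset.range k, (i : ℚ) ^ (p - 1) =
          (k - 1) + ∑ i ∈ Finset.Ico 1 k, ((i : ℚ) ^ (p - 1) - 1) := by
        rw [Finset.range_eq_Ico, Finset.sum_eq_sum_Ico_succ_bot (by omega),
          Finset.sum_sub_distrib]
        have : p - 1 ≠ 0 := by omega
        simp [this, Nat.cast_sub hk.1]
      have h5 : (k : ℚ) ^ (n - 1) * ∑ i ∈ Finset.range k, (i : ℚ) ^ (p - 1) -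
          ((k : ℚ) ^ n - (k : ℚ) ^ (n - 1)) =
          (k : ℚ) ^ (n - 1) * ∑ i ∈ Finset.Ico 1 k, ((i : ℚ) ^ (p - 1) - 1) := by
        rw [h3, h4]; ring
      rw [h5]
      refine ((PDvd.natCast k).pow _).mul_left (PDvd.sum fun i hi => ?_)
      rw [Finset.mem_Ico] at hi
      exact fermat_mod (Finset.mem_Icc.2 ⟨hi.1, by omega⟩)
    have h2 := PDvd.sum h1
    rw [Finset.sum_sub_distrib, Finset.sum_sub_distrib] at h2
    have h3 := sum_pow_mod_zero (hnd n (by omega) (by omega))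
    have h4 := sum_pow_mod_zero (hnd (n - 1) (by omega) (by omega))
    convert h2.add (h3.sub h4) using 1
    ring
  have hmem : n ∈ Finset.Ico 1 (p - 1) := Finset.mem_Ico.2 ⟨by omega, by omega⟩
  rw [← Finset.add_sum_erase _ _ hmem]
  have hS : ∀ t, ∑ k ∈ Finset.Icc 1 (p - 1), (p.choose t : ℚ) / p * bernoulli t *
        ((k : ℚ) ^ (n - 1 + (p - t)) - (k : ℚ) ^ n) = (p.choose t : ℚ) / p * bernoulli t *
        (∑ k ∈ Finset.Icc 1 (p - 1), (k : ℚ) ^ (n - 1 + (p - t))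
          - ∑ k ∈ Finset.Icc 1 (p - 1), (k : ℚ) ^ n) := by
    intro t
    rw [← Finset.mul_sum, Finset.sum_sub_distrib]
  have hB : PDvd p 1 (∑ t ∈ (Finset.Ico 1 (p - 1)).erase n, ∑ k ∈ Finset.Icc 1 (p - 1),
      (p.choose t : ℚ) / p * bernoulli t * ((k : ℚ) ^ (n - 1 + (p - t)) - (k : ℚ) ^ n)) := by
    refine PDvd.sum fun t ht => ?_
    rw [Finset.mem_erase, Finset.mem_Ico] at ht
    rw [hS]
    refine PDvd.mul_left ((choose_div_int (by omega) (by omega)).mul_left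
      (bernoulli_int (by omega))) (PDvd.sub ?_ (sum_pow_mod_zero (hnd n (by omega) (by omega))))
    refine sum_pow_mod_zero ?_
    rintro ⟨c, hc⟩
    have hc1 : 0 < c := by
      rcases Nat.eq_zero_or_pos c with rfl | hc0
      · simp at hc; omega
      · exact hc0
    rcases Nat.lt_or_ge c 2 with hc2 | hc2
    · have : c = 1 := by omega
      subst this
      omega
    · have : (p - 1) * 2 ≤ (p - 1) * c := Nat.mul_le_mul_left _ hc2
      omega
  have hC : PDvd p 1 (-(∑ k ∈ Finset.Icc 1 (p - 1), (p.choose n : ℚ) / p * bernoulli n *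
        ((k : ℚ) ^ (n - 1 + (p - n)) - (k : ℚ) ^ n)) + bernoulli n / n) := by
    rw [hS]
    have he : n - 1 + (p - n) = p - 1 := by omega
    rw [he]
    have h1 := sum_pow_mod (p := p) (p - 1)
    rw [if_pos dvd_rfl] at h1
    have h2 := sum_pow_mod_zero (hnd n (by omega) (by omega))
    have h3 := choose_div_mod (p := p) (t := n) (by omega) (by omega)
    rw [hev.neg_one_pow] at h3
    have hb := bernoulli_int (p := p) (n := n) h
    have hc := choose_div_int (p := p) (t := n) (by omega) (by omega)
    have h4 := ((hc.mul_left hb).mul_left (h2.sub h1)).add (hb.mul_left h3)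
    convert h4 using 1
    ring
  convert (hA.add hC).sub hB using 1
  ring

lemma harm_int {k m : ℕ} (hk : k ∈ Finset.Icc 1 (p - 1)) : PDvd p 0 (1 / (k : ℚ) ^ m) := by
  rw [Finset.mem_Icc] at hk
  have hpp := hp.out.pos
  rw [one_div, ← inv_pow]
  exact (PDvd.inv_lt (by omega) (by omega)).pow m

/-- `H_{p-1}(m) ≡ 0 (mod p)`. -/
lemma harm_mod {m : ℕ} (h0 : 0 < m) (h : m < p - 1) :
    PDvd p 1 (∑ k ∈ Finset.Icc 1 (p - 1), 1 / (k : ℚ) ^ m) := by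
  have h1 := sum_pow_mod_zero (p := p) (e := p - 1 - m)
    (Nat.not_dvd_of_pos_of_lt (by omega) (by omega))
  have h2 : PDvd p 1 (∑ k ∈ Finset.Icc 1 (p - 1), (1 / (k : ℚ) ^ m * ((k : ℚ) ^ (p - 1) - 1))) :=
    PDvd.sum fun k hk => (harm_int hk).mul_left (fermat_mod hk)
  convert h1.sub h2 using 1
  rw [← Finset.sum_sub_distrib]
  refine Finset.sum_congr rfl fun k hk => ?_
  rw [Finset.mem_Icc] at hk
  have hk0 : (k : ℚ) ≠ 0 := by
    have : k ≠ 0 := by omega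
    exact_mod_cast this
  have h3 : (k : ℚ) ^ (p - 1) = (k : ℚ) ^ (p - 1 - m) * (k : ℚ) ^ m := by
    rw [← pow_add]; congr 1; omega
  rw [h3]
  field_simp
  ring

/-- `H_{p-1}(m) ≡ m / (m+1) p B_{p-1-m} (mod p²)` for even `m`. -/
lemma harm_sq {m : ℕ} (h0 : 0 < m) (hev : Even m) (h : m + 3 ≤ p) :
    PDvd p 2 (∑ k ∈ Finset.Icc 1 (p - 1), 1 / (k : ℚ) ^ m
      - m / (m + 1) * bernoulli (p - m - 1) * p) := by
  have hodd : Odd p := hp.out.odd_of_ne_two (by omega)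
  have hpp := hp.out.pos
  have hp0 : (p : ℚ) ≠ 0 := by exact_mod_cast hpp.ne'
  obtain ⟨n, hn⟩ : ∃ n, n = p - m - 1 := ⟨_, rfl⟩
  rw [← hn]
  have hpn : p = n + m + 1 := by omega
  have hnev : Even n := by
    obtain ⟨a, ha⟩ := hev
    obtain ⟨b, hb⟩ := hodd
    exact ⟨b - a, by omega⟩
  have h1 := sum_pow_sq (p := p) (n := n) (by omega) (by omega)
  have h2 : PDvd p 2 ((p : ℚ) * (∑ k ∈ Finset.Icc 1 (p - 1),
      (k : ℚ) ^ n * (((k : ℚ) ^ (p - 1) - 1) / p) + bernoulli n / n)) :=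
    PDvd.mul (i := 1) (j := 1) PDvd.self
      (sum_pow_quot (p := p) (n := n) (by omega) hnev (by omega))
  have h3 : PDvd p 2 (∑ k ∈ Finset.Icc 1 (p - 1),
      (1 / (k : ℚ) ^ m * (((k : ℚ) ^ (p - 1) - 1) * ((k : ℚ) ^ (p - 1) - 1)))) :=
    PDvd.sum fun k hk => (harm_int hk).mul_left (PDvd.mul (i := 1) (j := 1) (fermat_mod hk) (fermat_mod hk))
  have h4 : PDvd p 2 ((p : ℚ) * p * (bernoulli n * ((n : ℚ)⁻¹ * ((m + 1 : ℕ) : ℚ)⁻¹))) :=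
    PDvd.mul_right (PDvd.mul (i := 1) (j := 1) PDvd.self PDvd.self) ((bernoulli_int (by omega)).mul_left
      ((PDvd.inv_lt (by omega) (by omega)).mul_left (PDvd.inv_lt (by omega) (by omega))))
  have h5 : ∑ k ∈ Finset.Icc 1 (p - 1), 1 / (k : ℚ) ^ m =
      ∑ k ∈ Finset.Icc 1 (p - 1), (k : ℚ) ^ n
      - p * ∑ k ∈ Finset.Icc 1 (p - 1), (k : ℚ) ^ n * (((k : ℚ) ^ (p - 1) - 1) / p)
      + ∑ k ∈ Finset.Icc 1 (p - 1),
      (1 / (k : ℚ) ^ m * (((k : ℚ) ^ (p - 1) - 1) * ((k : ℚ) ^ (p - 1) - 1))) := by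
    rw [Finset.mul_sum, ← Finset.sum_sub_distrib, ← Finset.sum_add_distrib]
    refine Finset.sum_congr rfl fun k hk => ?_
    rw [Finset.mem_Icc] at hk
    have hk0 : (k : ℚ) ≠ 0 := by
      have : k ≠ 0 := by omega
      exact_mod_cast this
    have h6 : (k : ℚ) ^ (p - 1) = (k : ℚ) ^ n * (k : ℚ) ^ m := by
      rw [← pow_add]; congr 1; omega
    rw [h6]
    field_simp
    ring
  rw [h5]
  convert ((h1.sub h2).add h3).add h4 using 1
  have hn0 : (n : ℚ) ≠ 0 := by
    have : n ≠ 0 := by omega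
    exact_mod_cast this
  have hm0 : (m : ℚ) + 1 ≠ 0 := by positivity
  have hpq : (p : ℚ) = n + m + 1 := by exact_mod_cast hpn
  have h7 : (p : ℚ) * p * (bernoulli n * ((n : ℚ)⁻¹ * ((m + 1 : ℕ) : ℚ)⁻¹)) =
      p * bernoulli n * ((n + m + 1) * ((n : ℚ)⁻¹ * ((m + 1 : ℕ) : ℚ)⁻¹)) := by
    rw [← hpq]; ring
  rw [h7]
  push_cast
  have h8 : ((n : ℚ) + m + 1) * ((n : ℚ)⁻¹ * ((m : ℚ) + 1)⁻¹) = (n : ℚ)⁻¹ + ((m : ℚ) + 1)⁻¹ := by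
    field_simp
    ring
  have h9 : (m : ℚ) / (m + 1) = 1 - ((m : ℚ) + 1)⁻¹ := by
    field_simp
    ring
  rw [h8, h9]
  ring

end basics

lemma multiset_esymm_cons (a : ℚ) (t : Multiset ℚ) (k : ℕ) :
    (a ::ₘ t).esymm (k + 1) = t.esymm (k + 1) + a * t.esymm k := by
  simp only [Multiset.esymm, Multiset.powersetCard_cons, Multiset.map_add, Multiset.sum_add,
    Multiset.map_map]
  congr 1
  rw [← Multiset.sum_map_mul_left]
  simp [Function.comp_def]

lemma AMHS_eq_esymm (s d n : ℕ) : AMHS n (List.replicate d (s, (1 : ℚ))) =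
    ((Finset.univ : Finset (Fin n)).val.map
      (fun i : Fin n => 1 / (((i : ℕ) + 1 : ℕ) : ℚ) ^ s)).esymm d := by
  induction n generalizing d with
  | zero =>
    cases d with
    | zero => simp [AMHS, Multiset.esymm]
    | succ d => simp [AMHS, Multiset.esymm, List.replicate_succ, Multiset.powersetCard_zero_right]
  | succ n ih =>
    cases d with
    | zero => simp [AMHS, Multiset.esymm]
    | succ d =>
      have h1 : ((Finset.univ : Finset (Fin (n + 1))).val.map
          (fun i : Fin (n + 1) => 1 / (((i : ℕ) + 1 : ℕ) : ℚ) ^ s)) =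
          (1 / ((n + 1 : ℕ) : ℚ) ^ s) ::ₘ ((Finset.univ : Finset (Fin n)).val.map
          (fun i : Fin n => 1 / (((i : ℕ) + 1 : ℕ) : ℚ) ^ s)) := by
        rw [Fin.univ_castSuccEmb]
        simp [Finset.cons_val, Finset.map_val, Multiset.map_map, Function.comp_def]
      rw [h1, multiset_esymm_cons, ← ih, ← ih, List.replicate_succ]
      simp only [AMHS]
      rw [Finset.sum_Icc_succ_top (by omega)]
      simp

lemma newton_AMHS (s d n : ℕ) : (d : ℚ) * AMHS n (List.replicate d (s, (1 : ℚ))) =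
    (-1) ^ (d + 1) * ∑ a ∈ Finset.HasAntidiagonal.antidiagonal d with a.1 < d,
      (-1) ^ a.1 * AMHS n (List.replicate a.1 (s, (1 : ℚ))) *
        ∑ k ∈ Finset.Icc 1 n, 1 / (k : ℚ) ^ (a.2 * s) := by
  have h := congrArg (MvPolynomial.aeval
    (fun i : Fin n => 1 / (((i : ℕ) + 1 : ℕ) : ℚ) ^ s)) (MvPolynomial.mul_esymm_eq_sum (Fin n) ℚ d)
  simp only [map_mul, map_natCast, map_pow, map_neg, map_one, map_sum,
    MvPolynomial.aeval_esymm_eq_multiset_esymm, ← AMHS_eq_esymm] at h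
  rw [h]
  congr 1
  refine Finset.sum_congr rfl fun a _ => ?_
  congr 1
  simp only [MvPolynomial.psum, map_sum, map_pow, MvPolynomial.aeval_X]
  have h2 : Finset.Icc 1 n = Finset.Ico 1 (n + 1) := by
    ext; simp [Nat.lt_succ_iff]
  rw [h2, Finset.sum_Ico_eq_sum_range, Nat.add_sub_cancel, Finset.sum_range]
  refine Finset.sum_congr rfl fun i _ => ?_
  rw [div_pow, one_pow, ← pow_mul, mul_comm s, add_comm]

lemma AMHS_int {p : ℕ} [hp : Fact p.Prime] (s d n : ℕ) (hn : n ≤ p - 1) :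
    PDvd p 0 (AMHS n (List.replicate d (s, (1 : ℚ)))) := by
  induction d generalizing n with
  | zero => simpa [AMHS] using PDvd.one
  | succ d ih =>
    rw [List.replicate_succ]
    simp only [AMHS, one_pow]
    refine PDvd.sum fun k hk => ?_
    rw [Finset.mem_Icc] at hk
    exact (harm_int (Finset.mem_Icc.2 ⟨hk.1, by omega⟩)).mul_left (ih _ (by omega))

lemma AMHS_mod {p : ℕ} [hp : Fact p.Prime] {s d : ℕ} (hs : 0 < s) (hd : 0 < d)
    (h : d * s < p - 1) : PDvd p 1 (AMHS (p - 1) (List.replicate d (s, (1 : ℚ)))) := by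
  have hds : d ≤ d * s := Nat.le_mul_of_pos_right d hs
  refine PDvd.of_mul hd (by omega) ?_
  rw [newton_AMHS]
  refine (PDvd.one.neg.pow _).mul_left (PDvd.sum fun a ha => ?_)
  rw [Finset.mem_filter, Finset.HasAntidiagonal.mem_antidiagonal] at ha
  refine PDvd.mul_left ((PDvd.one.neg.pow _).mul_left (AMHS_int _ _ _ le_rfl)) ?_
  have : a.2 * s ≤ d * s := Nat.mul_le_mul_right s (by omega)
  exact harm_mod (Nat.mul_pos (by omega) hs) (by omega)

/-- Theorem `thm:homogeneousWols2`, even weight case.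
For positive integers `d, s` with `d*s` even, for all sufficiently large primes `p`:
`H_{p-1}({s}^d) ≡ (-1)^{d-1} · s · (B_{p-ds-1}/(ds+1)) · p (mod p²)`. -/
theorem homogeneous_superbity_two (d s : ℕ) (hd : 0 < d) (hs : 0 < s)
    (h : Even (d * s)) :
    ∃ N, ∀ p ≥ N, Nat.Prime p →
      RatModEq p 2 (AMHS (p - 1) (List.replicate d (s, (1 : ℚ))))
        ((-1 : ℚ) ^ (d - 1) * (s : ℚ) *
          (bernoulli (p - d * s - 1) / ((d * s : ℕ) + 1 : ℚ)) * (p : ℚ)) := by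
  refine ⟨d * s + 3, fun p hpN hprime => ?_⟩
  haveI hp : Fact p.Prime := ⟨hprime⟩
  have hds : d ≤ d * s := Nat.le_mul_of_pos_right d hs
  refine PDvd.ratModEq (PDvd.of_mul hd (by omega) ?_)
  have hmem : ((0, d) : ℕ × ℕ) ∈ (Finset.HasAntidiagonal.antidiagonal d).filter (fun a => a.1 < d) := by
    simp [hd]
  rw [mul_sub, newton_AMHS, ← Finset.add_sum_erase _ _ hmem]
  have h1 : PDvd p 2 (∑ a ∈ ((Finset.HasAntidiagonal.antidiagonal d).filter (fun a => a.1 < d)).erase (0, d),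
      (-1) ^ a.1 * AMHS (p - 1) (List.replicate a.1 (s, (1 : ℚ))) *
        ∑ k ∈ Finset.Icc 1 (p - 1), 1 / (k : ℚ) ^ (a.2 * s)) := by
    refine PDvd.sum fun a ha => ?_
    rw [Finset.mem_erase, Finset.mem_filter, Finset.HasAntidiagonal.mem_antidiagonal] at ha
    obtain ⟨hne, hadd, hlt⟩ := ha
    have h0 : 0 < a.1 := by
      rcases Nat.eq_zero_or_pos a.1 with h0 | h0
      · exact absurd (Prod.ext h0 (by simpa [h0] using hadd)) hne
      · exact h0
    have h2 : a.2 * s ≤ d * s := Nat.mul_le_mul_right s (by omega)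
    have h3 : a.1 * s ≤ d * s := Nat.mul_le_mul_right s (by omega)
    exact PDvd.mul (i := 1) (j := 1)
      ((PDvd.one.neg.pow _).mul_left (AMHS_mod hs h0 (by omega)))
      (harm_mod (Nat.mul_pos (by omega) hs) (by omega))
  have h2 := harm_sq (p := p) (Nat.mul_pos hd hs) h hpN
  have h3 := (PDvd.one (p := p).neg.pow (d + 1)).mul_left (h2.add h1)
  convert h3 using 1
  have h4 : (-1 : ℚ) ^ (d - 1) = (-1) ^ (d + 1) := by
    have : d + 1 = d - 1 + 2 := by omega
    rw [this, pow_add]; norm_num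
  rw [h4]
  simp only [pow_zero, List.replicate_zero, AMHS]
  push_cast
  ring
end

section
/- Let d and s be positive integers with ds odd. Then for all sufficiently large primes p: H_{p−1}({s}^d) ≡ (−1)^{d} · (s(ds+1)/2) · (B_{p−ds−2}/(ds+2)) · p² (mod p³), where {s}^d denotes s repeated d times. -/
open scoped BigOperators

set_option linter.unusedSectionVars false

namespace HSup

open Finset

/-- `x` is divisible by `p^ℓ` in the localization of `ℤ` at `p`. -/
def Dv (p l : ℕ) (x : ℚ) : Prop := padicNorm p x ≤ (p : ℚ) ^ (-(l : ℤ))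

section basics
variable {p : ℕ} [hp : Fact p.Prime]

lemma Dv.zero (l : ℕ) : Dv p l 0 := by
  unfold Dv
  rw [padicNorm.zero]
  positivity

lemma Dv.add {l : ℕ} {x y : ℚ} (hx : Dv p l x) (hy : Dv p l y) : Dv p l (x + y) :=
  le_trans padicNorm.nonarchimedean (max_le hx hy)

lemma Dv.sub {l : ℕ} {x y : ℚ} (hx : Dv p l x) (hy : Dv p l y) : Dv p l (x - y) :=
  le_trans padicNorm.sub (max_le hx hy)

lemma Dv.neg {l : ℕ} {x : ℚ} (hx : Dv p l x) : Dv p l (-x) := by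
  unfold Dv at *
  rwa [padicNorm.neg]

lemma Dv.mul {a b : ℕ} {x y : ℚ} (hx : Dv p a x) (hy : Dv p b y) : Dv p (a + b) (x * y) := by
  unfold Dv at *
  have h0 : (p : ℚ) ≠ 0 := by exact_mod_cast hp.1.ne_zero
  rw [padicNorm.mul]
  have : (p : ℚ) ^ (-((a + b : ℕ) : ℤ)) = (p : ℚ) ^ (-(a : ℤ)) * (p : ℚ) ^ (-(b : ℤ)) := by
    rw [← zpow_add₀ h0]; congr 1; push_cast; ring
  rw [this]
  exact mul_le_mul hx hy (padicNorm.nonneg _) (by positivity)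

lemma Dv.mono {a b : ℕ} {x : ℚ} (hx : Dv p b x) (h : a ≤ b) : Dv p a x := by
  unfold Dv at *
  refine hx.trans (zpow_le_zpow_right₀ ?_ (by omega))
  exact_mod_cast hp.1.one_lt.le

lemma Dv.int {l : ℕ} {z : ℤ} (h : ((p ^ l : ℕ) : ℤ) ∣ z) : Dv p l (z : ℚ) :=
  padicNorm.dvd_iff_norm_le.1 h

lemma Dv.int0 (z : ℤ) : Dv p 0 (z : ℚ) := Dv.int (by simp)

lemma Dv.nat0 (z : ℕ) : Dv p 0 (z : ℚ) := by
  have := Dv.int0 (p := p) (z : ℤ)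
  exact_mod_cast this

lemma Dv.p1 : Dv p 1 (p : ℚ) := by
  have := Dv.int (p := p) (l := 1) (z := (p : ℤ)) (by simp)
  exact_mod_cast this

lemma Dv.ppow (l : ℕ) : Dv p l ((p : ℚ) ^ l) := by
  have := Dv.int (p := p) (l := l) (z := (p : ℤ) ^ l) (by simp)
  exact_mod_cast this

lemma Dv.pow0 {x : ℚ} (hx : Dv p 0 x) (n : ℕ) : Dv p 0 (x ^ n) := by
  induction n with
  | zero => simpa using Dv.nat0 (p := p) 1
  | succ n ih => rw [pow_succ]; exact ih.mul hx

lemma Dv.sum {ι : Type*} {l : ℕ} {s : Finset ι} {f : ι → ℚ} (h : ∀ i ∈ s, Dv p l (f i)) :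
    Dv p l (∑ i ∈ s, f i) := by
  classical
  induction s using Finset.induction_on with
  | empty => simpa using Dv.zero l
  | insert a s ha ih =>
    rw [Finset.sum_insert ha]
    exact (h a (by simp)).add (ih fun i hi => h i (by simp [hi]))

lemma Dv.smul {l : ℕ} {c x : ℚ} (hc : Dv p 0 c) (hx : Dv p l x) : Dv p l (c * x) := by
  have := hc.mul hx
  rwa [zero_add] at this

lemma Dv.inv {k : ℕ} (hk : ¬ p ∣ k) : Dv p 0 ((k : ℚ)⁻¹) := by
  unfold Dv
  have h := (padicNorm.nat_eq_one_iff (p := p) k).2 hk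
  have h2 := padicNorm.div (p := p) 1 (k : ℚ)
  rw [one_div] at h2
  rw [h2, h]
  simp

lemma Dv.cancel {l k : ℕ} {x : ℚ} (hk : ¬ p ∣ k) (h : Dv p l (k * x)) : Dv p l x := by
  have h2 := (Dv.inv hk).smul h
  have hk0 : (k : ℚ) ≠ 0 := by
    rintro h0
    apply hk
    have : k = 0 := by exact_mod_cast h0
    simp [this]
  rwa [inv_mul_cancel_left₀ hk0] at h2

lemma Dv.ratModEq {l : ℕ} {a b : ℚ} (h : Dv p l (a - b)) : RatModEq p l a b := by
  unfold RatModEq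
  by_cases hab : a = b
  · exact Or.inl hab
  right
  unfold Dv at h
  rw [padicNorm.eq_zpow_of_nonzero (sub_ne_zero.2 hab)] at h
  have h1 : (1 : ℚ) < p := by exact_mod_cast hp.1.one_lt
  have := (zpow_le_zpow_iff_right₀ h1).1 h
  omega

/-- Fermat. -/
lemma fermat {k : ℕ} (hk : ¬ p ∣ k) : Dv p 1 ((k : ℚ) ^ (p - 1) - 1) := by
  have h1 : IsCoprime (k : ℤ) p := by
    rw [Nat.isCoprime_iff_coprime]
    exact ((Nat.Prime.coprime_iff_not_dvd hp.1).2 hk).symm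
  have h2 := Int.ModEq.pow_card_sub_one_eq_one hp.1 h1
  have h3 := h2.symm.dvd
  have := Dv.int (p := p) (l := 1) (z := (k : ℤ) ^ (p - 1) - 1) (by simpa using h3)
  exact_mod_cast this

/-- Integrality of small Bernoulli numbers. -/
lemma bern (n : ℕ) (h : n + 1 < p) : Dv p 0 (bernoulli n) := by
  induction n using Nat.strong_induction_on with
  | _ n ih =>
    have hs := sum_bernoulli (n + 1)
    rw [Finset.sum_range_succ, Nat.choose_succ_self_right] at hs
    have h1 : Dv p 0 (∑ k ∈ range n, ((n + 1).choose k : ℚ) * bernoulli k) :=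
      Dv.sum fun i hi => by
        have hi' := Finset.mem_range.1 hi
        exact (Dv.nat0 _).smul (ih i hi' (by omega))
    refine Dv.cancel (k := n + 1) (fun hd => ?_) ?_
    · have := Nat.le_of_dvd (by omega) hd
      omega
    · rw [← eq_sub_iff_add_eq'] at hs
      rw [hs]
      refine Dv.sub ?_ h1
      split_ifs
      · simpa using Dv.nat0 (p := p) 1
      · exact Dv.zero 0

lemma faul (j : ℕ) (hj : j + 1 < p) :
    Dv p 2 (∑ k ∈ range p, (k : ℚ) ^ j - p * bernoulli j) := by
  rw [sum_range_pow, Finset.sum_range_succ]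
  have hj0 : (j + 1 : ℚ) ≠ 0 := by positivity
  have e : bernoulli j * ((j + 1).choose j) * (p : ℚ) ^ (j + 1 - j) / (j + 1) = p * bernoulli j := by
    rw [Nat.choose_succ_self_right]
    have : j + 1 - j = 1 := by omega
    rw [this]
    push_cast
    field_simp
  rw [e, add_sub_cancel_right]
  refine Dv.sum fun i hi => ?_
  have hi' := Finset.mem_range.1 hi
  refine Dv.cancel (k := j + 1) (fun hd => ?_) ?_
  · have := Nat.le_of_dvd (by omega) hd
    omega
  · have : ((j + 1 : ℕ) : ℚ) * (bernoulli i * ((j + 1).choose i) * (p : ℚ) ^ (j + 1 - i) / (j + 1))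
        = (bernoulli i * ((j + 1).choose i)) * (p : ℚ) ^ (j + 1 - i) := by
      push_cast
      field_simp
    rw [this]
    refine Dv.smul ((bern i (by omega)).smul (Dv.nat0 _)) ((Dv.ppow (j + 1 - i)).mono (by omega))

/-- Doubling permutes nonzero residues. -/
lemma double_sum {l : ℕ} (hp2 : p ≠ 2) (f : ℕ → ℚ)
    (hf : ∀ k, ¬ p ∣ k → Dv p l (f (k + p) - f k)) :
    Dv p l (∑ k ∈ Icc 1 (p - 1), f (2 * k) - ∑ k ∈ Icc 1 (p - 1), f k) := by
  have hpp := hp.1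
  have h2 : p.Coprime 2 := (Nat.coprime_primes hpp Nat.prime_two).2 hp2
  have hpos : 0 < p := hpp.pos
  have hnd : ∀ k ∈ Icc 1 (p - 1), ¬ p ∣ 2 * k := by
    intro k hk hd
    rw [Finset.mem_Icc] at hk
    have := Nat.le_of_dvd (by omega) (h2.dvd_of_dvd_mul_left hd)
    omega
  have hmap : ∀ k ∈ Icc 1 (p - 1), 2 * k % p ∈ Icc 1 (p - 1) := by
    intro k hk
    have h1 := hnd k hk
    rw [Nat.dvd_iff_mod_eq_zero] at h1
    have := Nat.mod_lt (2 * k) hpos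
    rw [Finset.mem_Icc]
    omega
  have hinj : Set.InjOn (fun k => 2 * k % p) (Icc 1 (p - 1) : Finset ℕ) := by
    intro a ha b hb hab
    have ha' := Finset.mem_Icc.1 (Finset.mem_coe.1 ha)
    have hb' := Finset.mem_Icc.1 (Finset.mem_coe.1 hb)
    have h3 : a ≡ b [MOD p] := Nat.ModEq.cancel_left_of_coprime h2 hab
    exact Nat.ModEq.eq_of_lt_of_lt h3 (by omega) (by omega)
  have himg : (Icc 1 (p - 1)).image (fun k => 2 * k % p) = Icc 1 (p - 1) := by
    apply Finset.eq_of_subset_of_card_le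
    · intro x hx
      obtain ⟨k, hk, rfl⟩ := Finset.mem_image.1 hx
      exact hmap k hk
    · rw [Finset.card_image_of_injOn hinj]
  have e : ∑ k ∈ Icc 1 (p - 1), f k = ∑ k ∈ Icc 1 (p - 1), f (2 * k % p) := by
    conv_lhs => rw [← himg]
    rw [Finset.sum_image hinj]
  rw [e, ← Finset.sum_sub_distrib]
  refine Dv.sum fun k hk => ?_
  have hk' := Finset.mem_Icc.1 hk
  rcases lt_or_ge (2 * k) p with hlt | hge
  · rw [Nat.mod_eq_of_lt hlt, sub_self]
    exact Dv.zero l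
  · have h3 : 2 * k % p = 2 * k - p := by
      rw [Nat.mod_eq_sub_mod hge, Nat.mod_eq_of_lt (by omega)]
    have h4 := hf (2 * k - p) (by
      intro hd
      apply hnd k hk
      have := Nat.dvd_add hd (dvd_refl p)
      rwa [Nat.sub_add_cancel hge] at this)
    rw [Nat.sub_add_cancel hge] at h4
    rwa [h3]

/-- power sums of inverses -/
def H (p m : ℕ) : ℚ := ∑ k ∈ Icc 1 (p - 1), ((k : ℚ)⁻¹) ^ m

lemma nd_of_mem {k : ℕ} (hk : k ∈ Icc 1 (p - 1)) : ¬ p ∣ k := by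
  intro hd
  have hk' := Finset.mem_Icc.1 hk
  have := Nat.le_of_dvd (by omega) hd
  have := hp.1.pos
  omega

lemma ne0_of_nd {k : ℕ} (hk : ¬ p ∣ k) : (k : ℚ) ≠ 0 := by
  intro h
  have : k = 0 := by exact_mod_cast h
  apply hk
  simp [this]

lemma nd_add {k : ℕ} (hk : ¬ p ∣ k) : ¬ p ∣ k + p := by
  intro h
  exact hk ((Nat.dvd_add_left (dvd_refl p)).1 h)

/-- `1/(k+p)^m ≡ 1/k^m - m p /k^(m+1)` mod `p^2`. -/
lemma inv_shift {k : ℕ} (hk : ¬ p ∣ k) (m : ℕ) :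
    Dv p 2 ((((k + p : ℕ) : ℚ)⁻¹) ^ m - (((k : ℚ)⁻¹) ^ m - m * p * ((k : ℚ)⁻¹) ^ (m + 1))) := by
  have hu := Dv.inv hk
  have hv := Dv.inv (nd_add hk)
  have hu0 := ne0_of_nd hk
  have hv0 := ne0_of_nd (nd_add hk)
  have huv : ((k + p : ℕ) : ℚ)⁻¹ = (k : ℚ)⁻¹ - p * (k : ℚ)⁻¹ ^ 2
      + p ^ 2 * ((k : ℚ)⁻¹ ^ 2 * ((k + p : ℕ) : ℚ)⁻¹) := by
    push_cast at hv0 ⊢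
    field_simp
    ring
  generalize ((k + p : ℕ) : ℚ)⁻¹ = v at *
  generalize (k : ℚ)⁻¹ = u at *
  induction m with
  | zero => simpa using Dv.zero 2
  | succ m ih =>
    have h1 := hv.smul ih
    have h2 : Dv p 2 (p ^ 2 * (u ^ 2 * v * u ^ m * (1 - m * p * u) + m * u ^ (m + 3))) := by
      refine (Dv.ppow 2).mul (b := 0) (Dv.add ?_ ?_)
      · refine (((hu.pow0 2).smul hv).smul (hu.pow0 m)).smul (Dv.sub ?_ ?_)
        · simpa using Dv.nat0 (p := p) 1
        · exact ((Dv.nat0 m).smul (Dv.nat0 p)).smul hu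
      · exact (Dv.nat0 m).smul (hu.pow0 _)
    have h3 := h1.add h2
    convert h3 using 1
    push_cast
    linear_combination (-(u ^ m * (1 - m * p * u))) * huv * (-1)

/-- `(a+p)^n ≡ a^n + n p a^(n-1)`. -/
lemma pow_shift (k n : ℕ) :
    Dv p 2 ((((k + p : ℕ) : ℚ)) ^ (n + 1) - ((k : ℚ) ^ (n + 1) + (n + 1) * p * (k : ℚ) ^ n)) := by
  have hk := Dv.nat0 (p := p) k
  have hkp := Dv.nat0 (p := p) (k + p)
  induction n with
  | zero => 
    convert Dv.zero (p := p) 2 using 1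
    push_cast; ring
  | succ n ih =>
    have h1 := hkp.smul ih
    have h2 : Dv p 2 (p ^ 2 * ((n + 1 : ℕ) * (k : ℚ) ^ n)) :=
      (Dv.ppow 2).mul (b := 0) ((Dv.nat0 (n + 1)).smul (hk.pow0 n))
    convert h1.add h2 using 1
    push_cast
    ring

lemma two_pow_nd (m : ℕ) (hm : 0 < m) (hlt : 2 ^ m < p) : ¬ p ∣ 2 ^ m - 1 := by
  intro hd
  have h1 : 2 ≤ 2 ^ m := by
    calc 2 = 2 ^ 1 := by norm_num
      _ ≤ 2 ^ m := Nat.pow_le_pow_right (by norm_num) hm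
  have := Nat.le_of_dvd (by omega) hd
  omega

lemma p_ne_two {m : ℕ} (hm : 0 < m) (hlt : 2 ^ m < p) : p ≠ 2 := by
  have h1 : 2 ≤ 2 ^ m := by
    calc 2 = 2 ^ 1 := by norm_num
      _ ≤ 2 ^ m := Nat.pow_le_pow_right (by norm_num) hm
  omega

/-- cancel `2^m - 1` -/
lemma cancel2 {l m : ℕ} (hm : 0 < m) (hlt : 2 ^ m < p) {x : ℚ}
    (h : Dv p l (((2 : ℚ)⁻¹) ^ m * x - x)) : Dv p l x := by
  refine Dv.cancel (two_pow_nd m hm hlt) ?_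
  have h2 := (Dv.nat0 (p := p) (2 ^ m)).smul h
  convert h2.neg using 1
  rw [Nat.cast_sub Nat.one_le_two_pow]
  push_cast
  rw [inv_pow]
  field_simp
  ring

lemma H_one (m : ℕ) (hm : 0 < m) (hlt : 2 ^ m < p) : Dv p 1 (H p m) := by
  have h := double_sum (p := p) (l := 1) (p_ne_two hm hlt) (fun k => ((k : ℚ)⁻¹) ^ m) (by
    intro k hk
    have h1 := (inv_shift hk m).mono (a := 1) (by norm_num)
    have h2 : Dv p 1 ((p : ℚ) * (m * ((k : ℚ)⁻¹) ^ (m + 1))) :=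
      Dv.p1.mul (b := 0) ((Dv.nat0 m).smul ((Dv.inv hk).pow0 _))
    convert h1.sub h2 using 1
    ring)
  apply cancel2 hm hlt
  convert h using 1
  unfold H
  rw [Finset.mul_sum]
  congr 1
  refine Finset.sum_congr rfl fun k _ => ?_
  push_cast
  rw [mul_inv, mul_pow]

/-- The sum of `k^(p-1-m)`. -/
lemma S_one (m : ℕ) (hm : 0 < m) (hlt : 2 ^ m < p) (hmp : m < p - 1) :
    Dv p 1 (∑ k ∈ Icc 1 (p - 1), (k : ℚ) ^ (p - 1 - m)) := by
  have h := H_one m hm hlt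
  have h2 : Dv p 1 (∑ k ∈ Icc 1 (p - 1), ((k : ℚ)⁻¹ ^ m * ((k : ℚ) ^ (p - 1) - 1))) :=
    Dv.sum fun k hk => ((Dv.inv (nd_of_mem hk)).pow0 m).smul (fermat (nd_of_mem hk))
  convert h.add h2 using 1
  unfold H
  rw [← Finset.sum_add_distrib]
  refine Finset.sum_congr rfl fun k hk => ?_
  have hk0 := ne0_of_nd (nd_of_mem hk)
  rw [pow_sub₀ _ hk0 (by omega), inv_pow]
  ring

lemma H_two (m : ℕ) (hm : 0 < m) (hlt : 2 ^ m < p) (hmp : m < p - 1) :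
    Dv p 2 ((m + 1) * H p m - m * ∑ k ∈ Icc 1 (p - 1), (k : ℚ) ^ (p - 1 - m)) := by
  obtain ⟨q, hq⟩ : ∃ q, p = q + 2 := ⟨p - 2, by omega⟩
  have h := double_sum (p := p) (l := 2) (p_ne_two hm hlt)
    (fun k => ((k : ℚ)⁻¹) ^ m * (m + 1 - m * (k : ℚ) ^ (p - 1))) (by
    intro k hk
    have hu := Dv.inv hk
    have hk0 := ne0_of_nd hk
    have h1 := inv_shift hk m
    have h2 := pow_shift (p := p) k q
    have h3 := fermat hk
    have hp1 : p - 1 = q + 1 := by omega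
    rw [hp1] at h3 ⊢
    have hq' : (q : ℚ) = p - 2 := by rw [hq]; push_cast; ring
    have hB : Dv p 0 ((m : ℚ) + 1 - m * ((k + p : ℕ) : ℚ) ^ (q + 1)) :=
      Dv.sub ((Dv.nat0 m).add (by simpa using Dv.nat0 (p := p) 1))
        ((Dv.nat0 m).smul ((Dv.nat0 _).pow0 _))
    have hA : Dv p 0 (((k : ℚ)⁻¹) ^ m - m * p * ((k : ℚ)⁻¹) ^ (m + 1)) :=
      (hu.pow0 m).sub (((Dv.nat0 m).smul (Dv.nat0 p)).smul (hu.pow0 _))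
    have t1 := hB.smul h1
    have t2 := (hA.smul ((Dv.nat0 m).smul h2)).neg
    have t3 : Dv p 2 ((p : ℚ) * ((k : ℚ) ^ (q + 1) - 1) * (m * (m + 1) * ((k : ℚ)⁻¹) ^ (m + 1))) := by
      refine (Dv.p1.mul h3).mul (b := 0) (Dv.smul ((Dv.nat0 m).smul ?_) (hu.pow0 _))
      exact_mod_cast Dv.nat0 (p := p) (m + 1)
    have t4 : Dv p 2 ((p : ℚ) ^ 2 * (m * m * (q + 1 : ℕ) * ((k : ℚ)⁻¹) ^ (m + 1) * (k : ℚ) ^ q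
        - m * ((k : ℚ)⁻¹) ^ m * (k : ℚ) ^ q)) := by
      refine (Dv.ppow 2).mul (b := 0) (Dv.sub ?_ ?_)
      · exact ((((Dv.nat0 m).smul (Dv.nat0 m)).smul (Dv.nat0 _)).smul (hu.pow0 _)).smul
          ((Dv.nat0 k).pow0 q)
      · exact ((Dv.nat0 m).smul (hu.pow0 _)).smul ((Dv.nat0 k).pow0 q)
    convert ((t1.add t2).add t3).add t4 using 1
    have e : (k : ℚ)⁻¹ * (k : ℚ) ^ (q + 1) = (k : ℚ) ^ q := by
      rw [pow_succ]; field_simp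
    have hq2 : ((q + 1 : ℕ) : ℚ) = p - 1 := by push_cast; rw [hq']; ring
    rw [hq2, hq', ← e]
    ring)
  have hS := S_one m hm hlt hmp
  have h2S : Dv p 2 (((2 : ℕ) : ℚ)⁻¹ ^ m * m * ((((2 : ℕ) : ℚ) ^ (p - 1) - 1) *
      ∑ k ∈ Icc 1 (p - 1), (k : ℚ) ^ (p - 1 - m))) := by
    have hn2 : ¬ p ∣ 2 := by
      rw [Nat.prime_dvd_prime_iff_eq hp.1 Nat.prime_two]
      exact p_ne_two hm hlt
    exact Dv.smul (((Dv.inv hn2).pow0 m).smul (Dv.nat0 m)) ((fermat hn2).mul hS)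
  apply cancel2 hm hlt
  have hS' : ∑ k ∈ Icc 1 (p - 1), (k : ℚ) ^ (p - 1 - m)
      = ∑ k ∈ Icc 1 (p - 1), ((k : ℚ)⁻¹) ^ m * (k : ℚ) ^ (p - 1) := by
    refine Finset.sum_congr rfl fun k hk => ?_
    have hk0 := ne0_of_nd (nd_of_mem hk)
    rw [pow_sub₀ _ hk0 (by omega), inv_pow]
    ring
  rw [hS'] at h2S ⊢
  convert h.add h2S using 1
  unfold H
  simp only [Finset.mul_sum, ← Finset.sum_sub_distrib, ← Finset.sum_add_distrib]
  refine Finset.sum_congr rfl fun k _ => ?_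
  push_cast
  rw [mul_inv, mul_pow, mul_pow]
  ring

/-- expansion of `1/(p-k)^w` -/
lemma refl_exp (w : ℕ) : ∃ c : ℕ, ∀ k ∈ Icc 1 (p - 1),
    Dv p 3 ((((p - k : ℕ) : ℚ)⁻¹) ^ w - (-1) ^ w * (((k : ℚ)⁻¹) ^ w + w * p * ((k : ℚ)⁻¹) ^ (w + 1)
      + c * p ^ 2 * ((k : ℚ)⁻¹) ^ (w + 2))) := by
  induction w with
  | zero =>
    refine ⟨0, fun k _ => ?_⟩
    convert Dv.zero (p := p) 3 using 1
    simp
  | succ w ih =>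
    obtain ⟨c, hc⟩ := ih
    refine ⟨c + w + 1, fun k hk => ?_⟩
    have ih := hc k hk
    have hk' := Finset.mem_Icc.1 hk
    have hmem : p - k ∈ Icc 1 (p - 1) := by
      rw [Finset.mem_Icc]; omega
    have hu := Dv.inv (nd_of_mem hk)
    have hv := Dv.inv (nd_of_mem hmem)
    have hu0 := ne0_of_nd (nd_of_mem hk)
    have hv0 := ne0_of_nd (nd_of_mem hmem)
    have huv : ((p - k : ℕ) : ℚ)⁻¹ = -(k : ℚ)⁻¹ - p * (k : ℚ)⁻¹ ^ 2 - p ^ 2 * (k : ℚ)⁻¹ ^ 3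
        + p ^ 3 * ((k : ℚ)⁻¹ ^ 3 * ((p - k : ℕ) : ℚ)⁻¹) := by
      rw [Nat.cast_sub (by omega)] at hv0 ⊢
      field_simp
      ring
    clear hc
    generalize ((p - k : ℕ) : ℚ)⁻¹ = v at *
    generalize (k : ℚ)⁻¹ = u at *
    have h1 := hv.smul ih
    have hm1 : Dv p 0 ((-1 : ℚ) ^ w) := Dv.pow0 (by simpa using Dv.int0 (p := p) (-1)) w
    have hpw := Dv.nat0 (p := p) p
    have h2 : Dv p 3 (p ^ 3 * ((-1) ^ w * ((u ^ 3 * v) * (u ^ w + w * p * u ^ (w + 1)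
        + c * p ^ 2 * u ^ (w + 2)) - (w * u ^ (w + 4) + c * u ^ (w + 4) + c * p * u ^ (w + 5))))) := by
      refine (Dv.ppow 3).mul (b := 0) (hm1.smul (Dv.sub (Dv.smul ((hu.pow0 3).smul hv)
        (Dv.add (Dv.add (hu.pow0 _) ?_) ?_)) (Dv.add (Dv.add ?_ ?_) ?_)))
      · exact ((Dv.nat0 w).smul hpw).smul (hu.pow0 _)
      · exact ((Dv.nat0 c).smul (hpw.pow0 2)).smul (hu.pow0 _)
      · exact (Dv.nat0 w).smul (hu.pow0 _)
      · exact (Dv.nat0 c).smul (hu.pow0 _)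
      · exact ((Dv.nat0 c).smul hpw).smul (hu.pow0 _)
    convert h1.add h2 using 1
    push_cast
    linear_combination ((-1) ^ w * (u ^ w + w * p * u ^ (w + 1)
        + c * p ^ 2 * u ^ (w + 2))) * huv

lemma H_three (w : ℕ) (hw : Odd w) (hlt : 2 ^ (w + 2) < p) :
    Dv p 3 (2 * H p w + w * p * H p (w + 1)) := by
  obtain ⟨c, hc⟩ := refl_exp (p := p) w
  have h1 := Dv.sum hc
  have hr : ∑ k ∈ Icc 1 (p - 1), (((p - k : ℕ) : ℚ)⁻¹) ^ w = H p w := by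
    unfold H
    refine Finset.sum_nbij' (fun k => p - k) (fun k => p - k) ?_ ?_ ?_ ?_ ?_
    · intro k hk; rw [Finset.mem_Icc] at *; omega
    · intro k hk; rw [Finset.mem_Icc] at *; omega
    · intro k hk; rw [Finset.mem_Icc] at hk; show p - (p - k) = k; omega
    · intro k hk; rw [Finset.mem_Icc] at hk; show p - (p - k) = k; omega
    · intro k hk; rfl
  have h2 : Dv p 3 (c * p ^ 2 * H p (w + 2)) := by
    rw [mul_assoc]
    exact (Dv.nat0 c).smul ((Dv.ppow 2).mul (H_one (w + 2) (by omega) hlt))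
  rw [Finset.sum_sub_distrib, hr] at h1
  convert h1.sub h2 using 1
  rw [← Finset.mul_sum, hw.neg_one_pow, Finset.sum_add_distrib, Finset.sum_add_distrib,
    ← Finset.mul_sum, ← Finset.mul_sum]
  unfold H
  ring

lemma H_odd (w : ℕ) (hw : Odd w) (hlt : 2 ^ (w + 2) < p) : Dv p 2 (H p w) := by
  have h1 := (H_three w hw hlt).mono (a := 2) (by norm_num)
  have h2 : Dv p 2 (w * (p * H p (w + 1))) :=
    (Dv.nat0 w).smul (Dv.p1.mul (H_one (w + 1) (by omega)
      (lt_of_le_of_lt (Nat.pow_le_pow_right (by norm_num) (by omega)) hlt)))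
  have hn2 : ¬ p ∣ 2 := by
    rw [Nat.prime_dvd_prime_iff_eq hp.1 Nat.prime_two]
    exact p_ne_two (by omega) hlt
  refine Dv.cancel hn2 ?_
  convert h1.sub h2 using 1
  push_cast
  ring

end basics

/-- Homogeneous multiple harmonic sums. -/
def E (s n d : ℕ) : ℚ := AMHS n (List.replicate d (s, (1 : ℚ)))

/-- Power sums. -/
def P (s n i : ℕ) : ℚ := ∑ k ∈ Icc 1 n, ((k : ℚ)⁻¹) ^ (s * i)

lemma E_zero (s n : ℕ) : E s n 0 = 1 := by simp [E, AMHS]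

lemma E_n0 (s d : ℕ) : E s 0 (d + 1) = 0 := by simp [E, AMHS, List.replicate_succ]

lemma E_succ (s n d : ℕ) :
    E s (n + 1) (d + 1) = E s n (d + 1) + (((n + 1 : ℕ) : ℚ)⁻¹) ^ s * E s n d := by
  simp only [E, List.replicate_succ, AMHS]
  rw [Finset.sum_Icc_succ_top (by omega)]
  simp

lemma P_succ (s n i : ℕ) :
    P s (n + 1) i = P s n i + ((((n + 1 : ℕ) : ℚ)⁻¹) ^ s) ^ i := by
  simp only [P]
  rw [Finset.sum_Icc_succ_top (by omega), pow_mul]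

lemma newton (s n d : ℕ) :
    (d : ℚ) * E s n d = ∑ i ∈ range d, (-1) ^ i * E s n (d - 1 - i) * P s n (i + 1) := by
  induction n generalizing d with
  | zero =>
    cases d with
    | zero => simp
    | succ d => simp [E_n0, P]
  | succ n ih =>
    cases d with
    | zero => simp
    | succ d =>
      set x : ℚ := (((n + 1 : ℕ) : ℚ)⁻¹) ^ s with hx
      have h1 := ih (d + 1)
      have h2 := ih d
      have tel : ∀ d : ℕ, ∑ i ∈ range d, (-1 : ℚ) ^ i * E s n (d - i) * x ^ (i + 1)
          + (-1) ^ d * x ^ (d + 1)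
          + ∑ i ∈ range d, (-1 : ℚ) ^ i * (x * E s n (d - 1 - i)) * x ^ (i + 1) = x * E s n d := by
        intro d
        cases d with
        | zero => simp [E_zero]
        | succ d =>
          rw [Finset.sum_range_succ' _ d, Finset.sum_range_succ _ d]
          have : ∑ i ∈ range d, (-1 : ℚ) ^ (i + 1) * E s n (d + 1 - (i + 1)) * x ^ (i + 1 + 1)
              = - ∑ i ∈ range d, (-1 : ℚ) ^ i * (x * E s n (d + 1 - 1 - i)) * x ^ (i + 1) := by
            rw [← Finset.sum_neg_distrib]
            refine Finset.sum_congr rfl fun i _ => ?_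
            have e1 : d + 1 - (i + 1) = d - i := by omega
            have e2 : d + 1 - 1 - i = d - i := by omega
            rw [e1, e2]
            ring
          rw [this]
          have e3 : d + 1 - 1 - d = 0 := by omega
          rw [e3, E_zero]
          simp only [Nat.sub_zero]
          ring
      have t := tel d
      rw [Finset.sum_range_succ] at h1 ⊢
      simp only [Nat.add_sub_cancel] at h1 ⊢
      rw [Nat.sub_self, E_zero] at h1 ⊢
      have e : ∑ i ∈ range d, (-1 : ℚ) ^ i * E s (n + 1) (d - i) * P s (n + 1) (i + 1)
          = ∑ i ∈ range d, (-1 : ℚ) ^ i * E s n (d - i) * P s n (i + 1)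
          + x * ∑ i ∈ range d, (-1 : ℚ) ^ i * E s n (d - 1 - i) * P s n (i + 1)
          + ∑ i ∈ range d, (-1 : ℚ) ^ i * E s n (d - i) * x ^ (i + 1)
          + ∑ i ∈ range d, (-1 : ℚ) ^ i * (x * E s n (d - 1 - i)) * x ^ (i + 1) := by
        rw [Finset.mul_sum, ← Finset.sum_add_distrib, ← Finset.sum_add_distrib,
          ← Finset.sum_add_distrib]
        refine Finset.sum_congr rfl fun i hi => ?_
        have hi' := Finset.mem_range.1 hi
        obtain ⟨j, hj⟩ : ∃ j, d - i = j + 1 := ⟨d - i - 1, by omega⟩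
        have hj2 : d - 1 - i = j := by omega
        rw [hj, hj2, E_succ, P_succ, ← hx]
        ring
      rw [e, E_succ, P_succ, ← hx, ← h2]
      push_cast at h1 ⊢
      linear_combination h1 - t

section final
variable {p : ℕ} [hp : Fact p.Prime]

lemma P_eq (s i : ℕ) : P s (p - 1) i = H p (s * i) := rfl

lemma nd_small {j : ℕ} (hj : 0 < j) (h : j < p) : ¬ p ∣ j := fun hd => by
  have := Nat.le_of_dvd hj hd
  omega

lemma pow_lt_of {a b : ℕ} (hab : a ≤ b) (h : 2 ^ b < p) : 2 ^ a < p :=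
  lt_of_le_of_lt (Nat.pow_le_pow_right (by norm_num) hab) h

lemma E_one (s d : ℕ) (hs : 0 < s) (hlt : 2 ^ (s * d) < p) (j : ℕ) (hj : 0 < j) (hjd : j ≤ d) :
    Dv p 1 (E s (p - 1) j) := by
  have hdp : d < p := lt_of_le_of_lt
    ((Nat.le_mul_of_pos_left d hs).trans Nat.lt_two_pow_self.le) hlt
  have hE : ∀ i, i ≤ d → Dv p 0 (E s (p - 1) i) := by
    intro i
    induction i using Nat.strong_induction_on with
    | _ i ih =>
      intro hi
      rcases Nat.eq_zero_or_pos i with rfl | hi0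
      · rw [E_zero]; simpa using Dv.nat0 (p := p) 1
      refine Dv.cancel (nd_small hi0 (by omega)) ?_
      rw [newton]
      refine Dv.sum fun k hk => ?_
      have hk' := Finset.mem_range.1 hk
      rw [P_eq]
      refine Dv.smul (Dv.smul (Dv.pow0 (by simpa using Dv.int0 (p := p) (-1)) k)
        (ih _ (by omega) (by omega))) ?_
      exact (H_one _ (by positivity) (pow_lt_of (Nat.mul_le_mul_left s (by omega)) hlt)).mono
        (by omega)
  refine Dv.cancel (nd_small hj (by omega)) ?_
  rw [newton]
  refine Dv.sum fun k hk => ?_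
  have hk' := Finset.mem_range.1 hk
  rw [P_eq]
  refine Dv.smul (Dv.smul (Dv.pow0 (by simpa using Dv.int0 (p := p) (-1)) k)
    (hE _ (by omega))) ?_
  exact H_one _ (by positivity) (pow_lt_of (Nat.mul_le_mul_left s (by omega)) hlt)

lemma E_odd (s d : ℕ) (hs : Odd s) (hlt : 2 ^ (s * d + 2) < p) (j : ℕ) (hj : Odd j)
    (hjd : j ≤ d) : Dv p 2 (E s (p - 1) j) := by
  have hs0 : 0 < s := hs.pos
  have hlt' : 2 ^ (s * d) < p := pow_lt_of (by omega) hlt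
  have hdp : d < p := lt_of_le_of_lt
    ((Nat.le_mul_of_pos_left d hs0).trans Nat.lt_two_pow_self.le) hlt'
  refine Dv.cancel (nd_small hj.pos (by omega)) ?_
  rw [newton]
  refine Dv.sum fun k hk => ?_
  have hk' := Finset.mem_range.1 hk
  have hm1 : Dv p 0 ((-1 : ℚ) ^ k) := Dv.pow0 (by simpa using Dv.int0 (p := p) (-1)) k
  have hle : s * (k + 1) ≤ s * d := Nat.mul_le_mul_left s (by omega)
  rw [P_eq, mul_assoc]
  refine hm1.smul ?_
  rcases Nat.even_or_odd (k + 1) with hk2 | hk2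
  · have hne : 0 < j - 1 - k := by
      rcases hj with ⟨a, ha⟩
      rcases hk2 with ⟨b, hb⟩
      omega
    exact (E_one s d hs0 hlt' _ hne (by omega)).mul (H_one _ (by positivity) (pow_lt_of hle hlt'))
  · have h2 : Dv p 2 (H p (s * (k + 1))) :=
      H_odd _ (hs.mul hk2) (pow_lt_of (by omega) hlt)
    rcases Nat.eq_zero_or_pos (j - 1 - k) with h0 | h0
    · rw [h0, E_zero, one_mul]; exact h2
    · exact ((E_one s d hs0 hlt' _ h0 (by omega)).mul h2).mono (by omega)

lemma E_main (s d : ℕ) (hs : Odd s) (hd : Odd d) (hlt : 2 ^ (s * d + 2) < p) :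
    Dv p 3 (d * E s (p - 1) d - H p (s * d)) := by
  have hs0 : 0 < s := hs.pos
  have hlt' : 2 ^ (s * d) < p := pow_lt_of (by omega) hlt
  rw [newton]
  obtain ⟨d', rfl⟩ : ∃ d', d = d' + 1 := ⟨d - 1, by have := hd.pos; omega⟩
  have hev : Even d' := by
    rcases hd with ⟨a, ha⟩
    exact ⟨a, by omega⟩
  rw [Finset.sum_range_succ, P_eq]
  have e0 : d' + 1 - 1 - d' = 0 := by omega
  rw [e0, E_zero, hev.neg_one_pow, one_mul, one_mul, add_sub_cancel_right]
  refine Dv.sum fun k hk => ?_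
  have hk' := Finset.mem_range.1 hk
  have hm1 : Dv p 0 ((-1 : ℚ) ^ k) := Dv.pow0 (by simpa using Dv.int0 (p := p) (-1)) k
  have hle : s * (k + 1) ≤ s * (d' + 1) := Nat.mul_le_mul_left s (by omega)
  rw [P_eq, mul_assoc]
  refine hm1.smul ?_
  rcases Nat.even_or_odd (k + 1) with hk2 | hk2
  · have hodd : Odd (d' + 1 - 1 - k) := by
      rcases hev with ⟨a, ha⟩
      rcases hk2 with ⟨b, hb⟩
      exact ⟨a - b, by omega⟩
    have a1 : Dv p 2 (E s (p - 1) (d' + 1 - 1 - k)) := E_odd s _ hs hlt _ hodd (by omega)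
    have a2 : Dv p 1 (H p (s * (k + 1))) := H_one _ (by positivity) (pow_lt_of hle hlt')
    exact (a1.mul a2).mono (by norm_num)
  · have a1 : Dv p 1 (E s (p - 1) (d' + 1 - 1 - k)) := E_one s _ hs0 hlt' _ (by omega) (by omega)
    have a2 : Dv p 2 (H p (s * (k + 1))) := H_odd _ (hs.mul hk2) (pow_lt_of (by omega) hlt)
    exact (a1.mul a2).mono (by norm_num)

lemma H_final (w : ℕ) (hw : Odd w) (hlt : 2 ^ (w + 5) < p) :
    Dv p 3 (2 * (w + 2) * H p w + w * (w + 1) * bernoulli (p - w - 2) * p ^ 2) := by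
  have hwp : w + 5 < p := Nat.lt_two_pow_self.trans hlt
  have h3 := H_three w hw (pow_lt_of (by omega) hlt)
  have h2 := H_two (p := p) (w + 1) (by omega) (pow_lt_of (by omega) hlt) (by omega)
  have e : p - 1 - (w + 1) = p - w - 2 := by omega
  rw [e] at h2
  have h1 := faul (p := p) (p - w - 2) (by omega)
  have hS : ∑ k ∈ range p, (k : ℚ) ^ (p - w - 2) = ∑ k ∈ Icc 1 (p - 1), (k : ℚ) ^ (p - w - 2) := by
    symm
    apply Finset.sum_subset
    · intro x hx
      rw [Finset.mem_Icc] at hx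
      rw [Finset.mem_range]
      omega
    · intro x hx hx'
      rw [Finset.mem_range] at hx
      rw [Finset.mem_Icc] at hx'
      have : x = 0 := by omega
      rw [this, Nat.cast_zero, zero_pow (by omega)]
  rw [hS] at h1
  have t1 := (Dv.nat0 (p := p) (w + 2)).smul h3
  have t2 := (Dv.nat0 (p := p) w).smul (Dv.p1.mul h2)
  have t3 := (Dv.nat0 (p := p) (w * (w + 1))).smul (Dv.p1.mul h1)
  convert (t1.sub t2).sub t3 using 1
  push_cast
  ring

end final

end HSup

/-- Theorem `thm:homogeneousWols2`, odd weight case.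
For positive integers `d, s` with `d*s` odd, for all sufficiently large primes `p`:
`H_{p-1}({s}^d) ≡ (-1)^d · (s(ds+1)/2) · (B_{p-ds-2}/(ds+2)) · p² (mod p³)`. -/
theorem homogeneous_superbity_three (d s : ℕ) (hd : 0 < d) (hs : 0 < s)
    (h : Odd (d * s)) :
    ∃ N, ∀ p ≥ N, Nat.Prime p →
      RatModEq p 3 (AMHS (p - 1) (List.replicate d (s, (1 : ℚ))))
        ((-1 : ℚ) ^ d * ((s : ℚ) * ((d * s : ℕ) + 1 : ℚ) / 2) *
          (bernoulli (p - d * s - 2) / ((d * s : ℕ) + 2 : ℚ)) * (p : ℚ) ^ 2) := by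
  refine ⟨2 ^ (d * s + 5) + 1, fun p hpN hpp => ?_⟩
  haveI : Fact p.Prime := ⟨hpp⟩
  have hdo : Odd d := (Nat.odd_mul.1 h).1
  have hso : Odd s := (Nat.odd_mul.1 h).2
  have hlt : 2 ^ (d * s + 5) < p := by omega
  have hwp : d * s + 5 < p := Nat.lt_two_pow_self.trans hlt
  have hle : d ≤ d * s := Nat.le_mul_of_pos_right d hs
  apply HSup.Dv.ratModEq
  have h1 := HSup.E_main (p := p) s d hso hdo
    (HSup.pow_lt_of (by rw [mul_comm]; omega) hlt)
  have h2 := HSup.H_final (p := p) (d * s) h hlt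
  rw [mul_comm s d] at h1
  refine HSup.Dv.cancel (k := d) (HSup.nd_small hd (by omega)) ?_
  refine HSup.Dv.cancel (k := d * s + 2) (HSup.nd_small (by omega) (by omega)) ?_
  refine HSup.Dv.cancel (k := 2) (HSup.nd_small (by omega) (by omega)) ?_
  have t1 := (HSup.Dv.nat0 (p := p) (2 * (d * s + 2))).smul h1
  convert t1.add h2 using 1
  have h0 : ((d * s : ℕ) : ℚ) + 2 ≠ 0 := by positivity
  rw [hdo.neg_one_pow]
  unfold HSup.E
  push_cast at h0 ⊢
  field_simp
  ring
end

section
/- Let s and t be positive integers with w = s+t odd. Then for all sufficiently large primes p: H_{p−1}(s̄,t) ≡ H_{p−1}(s,t̄) ≡ −H^⋆_{p−1}(s̄,t) ≡ −H^⋆_{p−1}(s,t̄) ≡ (1−2^{1−w})·B_{p−w}/w (mod p). Here (s̄,t) denotes the signed composition ((s,−1),(t,1)) and (s,t̄) denotes ((s,1),(t,−1)). -/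
open scoped BigOperators

/-- `a : ℚ` is `p`-integral with reduction `r`. -/
def Red (p : ℕ) [Fact p.Prime] (a : ℚ) (r : ZMod p) : Prop :=
  ∃ n d : ℤ, (d : ZMod p) ≠ 0 ∧ a = n / d ∧ r = n / d

section red
variable {p : ℕ} [Fact p.Prime]

lemma red_int (n : ℤ) : Red p (n : ℚ) (n : ZMod p) := ⟨n, 1, by simp, by simp, by simp⟩

lemma red_nat (n : ℕ) : Red p (n : ℚ) (n : ZMod p) := by
  simpa using red_int (p := p) (n : ℤ)

lemma red_one : Red p 1 1 := by simpa using red_nat (p := p) 1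
lemma red_zero : Red p 0 0 := by simpa using red_nat (p := p) 0
lemma red_two : Red p 2 2 := by simpa using red_nat (p := p) 2

lemma red_den {d : ℤ} (h : (d : ZMod p) ≠ 0) : (d : ℚ) ≠ 0 := by
  intro h0
  apply h
  have : d = 0 := by exact_mod_cast h0
  simp [this]

lemma Red.add {a b : ℚ} {r u : ZMod p} (h : Red p a r) (k : Red p b u) :
    Red p (a + b) (r + u) := by
  obtain ⟨n, d, hd, rfl, rfl⟩ := h
  obtain ⟨n', d', hd', rfl, rfl⟩ := k
  have := red_den hd
  have := red_den hd'
  refine ⟨n * d' + d * n', d * d', ?_, ?_, ?_⟩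
  · push_cast; exact mul_ne_zero hd hd'
  · push_cast; rw [div_add_div _ _ (by assumption) (by assumption)]
  · push_cast; rw [div_add_div _ _ (by assumption) (by assumption)]

lemma Red.mul {a b : ℚ} {r u : ZMod p} (h : Red p a r) (k : Red p b u) :
    Red p (a * b) (r * u) := by
  obtain ⟨n, d, hd, rfl, rfl⟩ := h
  obtain ⟨n', d', hd', rfl, rfl⟩ := k
  refine ⟨n * n', d * d', ?_, ?_, ?_⟩
  · push_cast; exact mul_ne_zero hd hd'
  · push_cast; rw [div_mul_div_comm]
  · push_cast; rw [div_mul_div_comm]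

lemma Red.neg {a : ℚ} {r : ZMod p} (h : Red p a r) : Red p (-a) (-r) := by
  simpa using (red_int (p := p) (-1)).mul h

lemma Red.sub {a b : ℚ} {r u : ZMod p} (h : Red p a r) (k : Red p b u) :
    Red p (a - b) (r - u) := by
  simpa [sub_eq_add_neg] using h.add k.neg

lemma Red.inv {a : ℚ} {r : ZMod p} (h : Red p a r) (hr : r ≠ 0) : Red p a⁻¹ r⁻¹ := by
  obtain ⟨n, d, hd, rfl, rfl⟩ := h
  refine ⟨d, n, ?_, ?_, ?_⟩
  · intro h; simp [h] at hr
  · simp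
  · simp

lemma Red.div {a b : ℚ} {r u : ZMod p} (h : Red p a r) (k : Red p b u) (hu : u ≠ 0) :
    Red p (a / b) (r / u) := by
  simpa [div_eq_mul_inv] using h.mul (k.inv hu)

lemma Red.pow {a : ℚ} {r : ZMod p} (h : Red p a r) (n : ℕ) : Red p (a ^ n) (r ^ n) := by
  induction n with
  | zero => simpa using red_one
  | succ n ih => simpa [pow_succ] using ih.mul h

lemma red_sum {ι : Type*} (S : Finset ι) (f : ι → ℚ) (g : ι → ZMod p)
    (h : ∀ i ∈ S, Red p (f i) (g i)) : Red p (∑ i ∈ S, f i) (∑ i ∈ S, g i) := by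
  classical
  induction S using Finset.induction_on with
  | empty => simpa using red_zero
  | insert a S ha ih =>
    rw [Finset.sum_insert ha, Finset.sum_insert ha]
    exact (h a (by simp)).add (ih fun i hi => h i (by simp [hi]))

lemma Red.eq_zero {r : ZMod p} (h : Red p 0 r) : r = 0 := by
  obtain ⟨n, d, hd, h0, rfl⟩ := h
  have := red_den hd
  have h1 : (n : ℚ) = 0 := by
    rcases div_eq_zero_iff.1 h0.symm with h | h
    · exact h
    · exact absurd h this
  have : n = 0 := by exact_mod_cast h1
  simp [this]

lemma Red.unique {a : ℚ} {r u : ZMod p} (h : Red p a r) (k : Red p a u) : r = u := by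
  have := h.sub k
  rw [sub_self] at this
  exact sub_eq_zero.1 this.eq_zero

lemma Red.modEq {a b : ℚ} {r : ZMod p} (h : Red p a r) (k : Red p b r) : RatModEq p 1 a b := by
  obtain ⟨n, d, hd, h1, h2⟩ := h.sub k
  by_cases hab : a = b
  · exact Or.inl hab
  right
  rw [sub_self] at h2
  have hd' := red_den hd
  have hn : (n : ZMod p) = 0 := by
    rcases div_eq_zero_iff.1 h2.symm with h | h
    · exact h
    · exact absurd h hd
  have hn0 : (n : ℚ) ≠ 0 := by
    intro h; apply hab; rw [h, zero_div] at h1; exact sub_eq_zero.1 h1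
  rw [h1, padicValRat.div hn0 hd', padicValRat.of_int, padicValRat.of_int]
  have hnd : ¬ (p : ℤ) ∣ d := by
    rw [← ZMod.intCast_zmod_eq_zero_iff_dvd]; exact hd
  have hpn : (p : ℤ) ∣ n := by
    rw [← ZMod.intCast_zmod_eq_zero_iff_dvd]; exact hn
  rw [padicValInt.eq_zero_of_not_dvd hnd]
  have : n ≠ 0 := by exact_mod_cast hn0
  have h3 := (padicValInt_dvd_iff (p := p) 1 n).1 (by simpa using hpn)
  have : 1 ≤ padicValInt p n := by tauto
  push_cast
  omega

lemma natCast_ne_zero_of_lt {k : ℕ} (h0 : 1 ≤ k) (hk : k < p) : (k : ZMod p) ≠ 0 := by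
  rw [Ne, ZMod.natCast_eq_zero_iff]
  exact Nat.not_dvd_of_pos_of_lt h0 hk

lemma red_AMHS1 {n s : ℕ} (hn : n < p) {ε : ℚ} {e : ZMod p} (he : Red p ε e) :
    Red p (AMHS n [(s, ε)]) (∑ k ∈ Finset.Icc 1 n, e ^ k / (k : ZMod p) ^ s) := by
  simp only [AMHS, mul_one]
  refine red_sum _ _ _ fun k hk => ?_
  rw [Finset.mem_Icc] at hk
  exact (he.pow k).div ((red_nat k).pow s)
    (pow_ne_zero _ (natCast_ne_zero_of_lt hk.1 (by omega)))

lemma red_AMHSstar1 {n s : ℕ} (hn : n < p) {ε : ℚ} {e : ZMod p} (he : Red p ε e) :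
    Red p (AMHSstar n [(s, ε)]) (∑ k ∈ Finset.Icc 1 n, e ^ k / (k : ZMod p) ^ s) := by
  simp only [AMHSstar, mul_one]
  refine red_sum _ _ _ fun k hk => ?_
  rw [Finset.mem_Icc] at hk
  exact (he.pow k).div ((red_nat k).pow s)
    (pow_ne_zero _ (natCast_ne_zero_of_lt hk.1 (by omega)))

lemma red_AMHS2 {n s t : ℕ} (hn : n < p) {ε η : ℚ} {e f : ZMod p} (he : Red p ε e)
    (hf : Red p η f) :
    Red p (AMHS n [(s, ε), (t, η)]) (∑ k ∈ Finset.Icc 1 n, e ^ k / (k : ZMod p) ^ s *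
      ∑ l ∈ Finset.Icc 1 (k - 1), f ^ l / (l : ZMod p) ^ t) := by
  rw [AMHS]
  refine red_sum _ _ _ fun k hk => ?_
  rw [Finset.mem_Icc] at hk
  exact ((he.pow k).div ((red_nat k).pow s)
    (pow_ne_zero _ (natCast_ne_zero_of_lt hk.1 (by omega)))).mul (red_AMHS1 (by omega) hf)

lemma red_AMHSstar2 {n s t : ℕ} (hn : n < p) {ε η : ℚ} {e f : ZMod p} (he : Red p ε e)
    (hf : Red p η f) :
    Red p (AMHSstar n [(s, ε), (t, η)]) (∑ k ∈ Finset.Icc 1 n, e ^ k / (k : ZMod p) ^ s *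
      ∑ l ∈ Finset.Icc 1 k, f ^ l / (l : ZMod p) ^ t) := by
  rw [AMHSstar]
  refine red_sum _ _ _ fun k hk => ?_
  rw [Finset.mem_Icc] at hk
  exact ((he.pow k).div ((red_nat k).pow s)
    (pow_ne_zero _ (natCast_ne_zero_of_lt hk.1 (by omega)))).mul (red_AMHSstar1 (by omega) hf)

lemma red_bernoulli (n : ℕ) (hn : n + 1 < p) : ∃ r, Red p (bernoulli n) r := by
  induction n using Nat.strong_induction_on with
  | _ n ih =>
    have h := sum_bernoulli (n + 1)
    rw [Finset.sum_range_succ, Nat.choose_succ_self_right] at h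
    have h2 : ∃ r, Red p (∑ k ∈ Finset.range n, ((n + 1).choose k : ℚ) * bernoulli k) r := by
      have : ∀ k : ℕ, ∃ r, k < n → Red p (bernoulli k) r := by
        intro k
        by_cases hk : k < n
        · obtain ⟨r, hr⟩ := ih k hk (by omega)
          exact ⟨r, fun _ => hr⟩
        · exact ⟨0, fun h => absurd h hk⟩
      choose g hg using this
      exact ⟨_, red_sum _ _ (fun k => ((n + 1).choose k : ZMod p) * g k) fun k hk =>
        (red_nat _).mul (hg k (Finset.mem_range.1 hk))⟩
    have h3 : ∃ r, Red p (if n + 1 = 1 then (1 : ℚ) else 0) r := by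
      split_ifs
      · exact ⟨_, red_one⟩
      · exact ⟨_, red_zero⟩
    obtain ⟨a, ha⟩ := h2
    obtain ⟨b, hb⟩ := h3
    have h4 : bernoulli n = ((if n + 1 = 1 then (1 : ℚ) else 0) -
        ∑ k ∈ Finset.range n, ((n + 1).choose k : ℚ) * bernoulli k) / ((n + 1 : ℕ) : ℚ) := by
      rw [eq_div_iff (by positivity), ← h]; ring
    rw [h4]
    exact ⟨_, (hb.sub ha).div (red_nat _) (natCast_ne_zero_of_lt (by omega) hn)⟩

lemma red_bernoulli_poly (n : ℕ) (hn : n + 1 < p) {x y : ℚ} {r : ZMod p} (hx : Red p x r)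
    (hy : Red p y r) : ∃ v, Red p ((Polynomial.bernoulli n).eval x) v ∧
      Red p ((Polynomial.bernoulli n).eval y) v := by
  have : ∀ k : ℕ, ∃ r, k ≤ n → Red p (bernoulli k) r := by
    intro k
    by_cases hk : k ≤ n
    · obtain ⟨r, hr⟩ := red_bernoulli (p := p) k (by omega)
      exact ⟨r, fun _ => hr⟩
    · exact ⟨0, fun h => absurd h hk⟩
  choose g hg using this
  have key : ∀ z, Red p z r → Red p ((Polynomial.bernoulli n).eval z)
      (∑ i ∈ Finset.range (n + 1), g i * (n.choose i : ZMod p) * r ^ (n - i)) := by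
    intro z hz
    simp only [Polynomial.bernoulli, Polynomial.eval_finsetSum, Polynomial.eval_monomial]
    exact red_sum _ _ _ fun i hi =>
      ((hg i (by simp at hi; omega)).mul (red_nat _)).mul (hz.pow _)
  exact ⟨_, key x hx, key y hy⟩

lemma bernoulli_half (n : ℕ) : (Polynomial.bernoulli n).eval (2⁻¹ : ℚ) =
    (2 / 2 ^ n - 1) * bernoulli n := by
  have h := bernoulliFun_eval_half n
  have h2 : bernoulliFun n 2⁻¹ = (((Polynomial.bernoulli n).eval (2⁻¹ : ℚ) : ℚ) : ℝ) := by
    rw [bernoulliFun]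
    have := Polynomial.eval_map_algebraMap (R := ℚ) (B := ℝ) (Polynomial.bernoulli n) 2⁻¹
    have e : (2⁻¹ : ℝ) = algebraMap ℚ ℝ 2⁻¹ := by simp
    rw [e, Polynomial.eval_map_algebraMap, Polynomial.aeval_algebraMap_apply]
    simp
  rw [h2] at h
  apply Rat.cast_injective (α := ℝ)
  rw [h]; push_cast; rfl

lemma sum_range_zmod (f : ZMod p → ZMod p) : ∑ k ∈ Finset.range p, f (k : ZMod p) = ∑ x, f x := by
  refine Finset.sum_bij (fun k _ => (k : ZMod p)) (by simp) ?_ ?_ (by simp)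
  · intro a ha b hb h
    rw [ZMod.natCast_eq_natCast_iff'] at h
    rwa [Nat.mod_eq_of_lt (Finset.mem_range.1 ha), Nat.mod_eq_of_lt (Finset.mem_range.1 hb)] at h
  · intro b _
    exact ⟨b.val, by simpa using ZMod.val_lt b, by simp⟩

lemma sum_range_pow_zero {m : ℕ} (hm : m < p - 1) :
    ∑ k ∈ Finset.range p, (k : ZMod p) ^ m = 0 := by
  rw [sum_range_zmod (fun x => x ^ m)]
  exact FiniteField.sum_pow_lt_card_sub_one _ m (by simpa using hm)

lemma Icc_eq_range (f : ℕ → ZMod p) (h0 : f 0 = 0) :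
    ∑ k ∈ Finset.Icc 1 (p - 1), f k = ∑ k ∈ Finset.range p, f k := by
  have hp := (Fact.out : p.Prime).pos
  refine Finset.sum_subset ?_ ?_
  · intro k; simp; omega
  · intro k hk hk'
    have : k = 0 := by simp at hk hk'; omega
    rw [this, h0]

lemma one_div_pow_eq {k w : ℕ} (h1 : 1 ≤ k) (hk : k < p) (hw : w ≤ p - 1) :
    (1 : ZMod p) / (k : ZMod p) ^ w = (k : ZMod p) ^ (p - 1 - w) := by
  have h := natCast_ne_zero_of_lt h1 hk
  rw [div_eq_iff (pow_ne_zero _ h), ← pow_add, Nat.sub_add_cancel hw, ZMod.pow_card_sub_one_eq_one h]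

lemma sum_inv_pow {t : ℕ} (ht : 0 < t) (htp : t < p - 1) :
    ∑ k ∈ Finset.Icc 1 (p - 1), (1 : ZMod p) ^ k / (k : ZMod p) ^ t = 0 := by
  have : ∑ k ∈ Finset.Icc 1 (p - 1), (1 : ZMod p) ^ k / (k : ZMod p) ^ t =
      ∑ k ∈ Finset.Icc 1 (p - 1), (k : ZMod p) ^ (p - 1 - t) := by
    refine Finset.sum_congr rfl fun k hk => ?_
    rw [Finset.mem_Icc] at hk
    rw [one_pow, one_div_pow_eq hk.1 (by omega) (by omega)]
  rw [this, Icc_eq_range (fun k => (k : ZMod p) ^ (p - 1 - t)), sum_range_pow_zero (by omega)]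
  simp; omega

lemma alt_sum (f : ℕ → ZMod p) (h : ℕ) : ∑ k ∈ Finset.range (2 * h + 1), (-1) ^ k * f k =
    2 * ∑ j ∈ Finset.range (h + 1), f (2 * j) - ∑ k ∈ Finset.range (2 * h + 1), f k := by
  induction h with
  | zero => simp; ring
  | succ h ih =>
    rw [show 2 * (h + 1) + 1 = 2 * h + 1 + 1 + 1 by ring, Finset.sum_range_succ,
      Finset.sum_range_succ, ih, Finset.sum_range_succ _ (h + 1),
      Finset.sum_range_succ _ (2 * h + 1 + 1), Finset.sum_range_succ _ (2 * h + 1)]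
    have : (-1 : ZMod p) ^ (2 * h) = 1 := by simp
    simp only [pow_succ, this]
    rw [show 2 * (h + 1) = 2 * h + 1 + 1 by ring]
    ring

/-- The depth one alternating sum. -/
lemma alt_diag {w : ℕ} (hw3 : 3 ≤ w) (hwp : w + 3 ≤ p) {β : ZMod p}
    (hβ : Red p (bernoulli (p - w)) β) :
    (w : ZMod p) * ∑ k ∈ Finset.Icc 1 (p - 1), (-1 : ZMod p) ^ k / (k : ZMod p) ^ w =
      - 2 * (1 - 2 / 2 ^ w) * β := by
  have hpp := (Fact.out : p.Prime)
  obtain ⟨h, hh⟩ : ∃ h, p = 2 * h + 1 := by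
    rcases hpp.eq_two_or_odd' with h | h
    · omega
    · exact h
  obtain ⟨m, hm⟩ : ∃ m, p = m + 1 + w := ⟨p - 1 - w, by omega⟩
  have hm0 : m ≠ 0 := by omega
  have h2 : (2 : ZMod p) ≠ 0 := by
    simpa using natCast_ne_zero_of_lt (p := p) (k := 2) (by omega) (by omega)
  have hpc : (p : ZMod p) = 0 := by simp
  -- rewrite as a power sum
  have e1 : ∑ k ∈ Finset.Icc 1 (p - 1), (-1 : ZMod p) ^ k / (k : ZMod p) ^ w =
      ∑ k ∈ Finset.Icc 1 (p - 1), (-1 : ZMod p) ^ k * (k : ZMod p) ^ m := by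
    refine Finset.sum_congr rfl fun k hk => ?_
    rw [Finset.mem_Icc] at hk
    rw [div_eq_mul_one_div, one_div_pow_eq hk.1 (by omega) (by omega),
      show p - 1 - w = m by omega]
  have e2 : ∑ k ∈ Finset.range p, (-1 : ZMod p) ^ k * (k : ZMod p) ^ m =
      2 * ∑ j ∈ Finset.range (h + 1), ((2 * j : ℕ) : ZMod p) ^ m := by
    have := alt_sum (p := p) (fun k => (k : ZMod p) ^ m) h
    rw [← hh, sum_range_pow_zero (by omega), sub_zero] at this
    exact this
  rw [e1, Icc_eq_range (fun k => (-1 : ZMod p) ^ k * (k : ZMod p) ^ m) (by simp [hm0]), e2]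
  -- Faulhaber
  have f1 := Polynomial.sum_range_pow_eq_bernoulli_sub (h + 1) m
  have hx : Red p (2⁻¹ : ℚ) (2⁻¹ : ZMod p) := red_two.inv h2
  have hy : Red p ((h + 1 : ℕ) : ℚ) (2⁻¹ : ZMod p) := by
    have : ((h + 1 : ℕ) : ZMod p) = 2⁻¹ := by
      apply eq_inv_of_mul_eq_one_left
      have : ((h + 1 : ℕ) : ZMod p) * 2 = ((2 * h + 1 : ℕ) : ZMod p) + 1 := by push_cast; ring
      rw [this, ← hh, hpc, zero_add]
    rw [← this]; exact red_nat _
  obtain ⟨v, hv1, hv2⟩ := red_bernoulli_poly (p := p) (m + 1) (by omega) hx hy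
  rw [show p - w = m + 1 by omega] at hβ
  rw [bernoulli_half] at hv1
  have hv3 : v = (2 / 2 ^ (m + 1) - 1) * β :=
    hv1.unique (((red_two.div (red_two.pow _) (pow_ne_zero _ h2)).sub red_one).mul hβ)
  have f2 : Red p (((m + 1 : ℕ) : ℚ) * ∑ k ∈ Finset.range (h + 1), (k : ℚ) ^ m)
      (((m + 1 : ℕ) : ZMod p) * ∑ k ∈ Finset.range (h + 1), (k : ZMod p) ^ m) :=
    (red_nat _).mul (red_sum _ _ _ fun k _ => (red_nat k).pow m)
  have f3 : ((m + 1 : ℕ) : ZMod p) * ∑ k ∈ Finset.range (h + 1), (k : ZMod p) ^ m = v - β := by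
    refine f2.unique ?_
    have : ((m + 1 : ℕ) : ℚ) * ∑ k ∈ Finset.range (h + 1), (k : ℚ) ^ m =
        Polynomial.eval ((h + 1 : ℕ) : ℚ) (Polynomial.bernoulli (m + 1)) - bernoulli (m + 1) := by
      simpa using f1
    rw [this]
    exact hv2.sub hβ
  have f4 : ((m + 1 : ℕ) : ZMod p) = - (w : ZMod p) := by
    rw [eq_neg_iff_add_eq_zero, ← Nat.cast_add, ← hm, hpc]
  have f5 : (2 : ZMod p) ^ m * 2 ^ w = 1 := by
    rw [← pow_add, show m + w = p - 1 by omega, ZMod.pow_card_sub_one_eq_one h2]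
  rw [f4, hv3] at f3
  have f6 : ∑ j ∈ Finset.range (h + 1), ((2 * j : ℕ) : ZMod p) ^ m =
      2 ^ m * ∑ j ∈ Finset.range (h + 1), (j : ZMod p) ^ m := by
    rw [Finset.mul_sum]
    refine Finset.sum_congr rfl fun j _ => ?_
    push_cast; rw [mul_pow]
  rw [f6]
  set S := ∑ j ∈ Finset.range (h + 1), (j : ZMod p) ^ m
  have hinv : (2 : ZMod p) ^ m = (2 ^ w)⁻¹ := eq_inv_of_mul_eq_one_left f5
  have hw2 : (2 : ZMod p) ^ w ≠ 0 := pow_ne_zero _ h2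
  have f7 : (w : ZMod p) * S = - ((2 ^ w - 2) * β) := by
    have : (2 : ZMod p) / 2 ^ (m + 1) = 2 ^ w := by
      rw [pow_succ, hinv]; field_simp
    rw [this] at f3
    linear_combination -f3
  calc (w : ZMod p) * (2 * (2 ^ m * S)) = 2 * 2 ^ m * (w * S) := by ring
    _ = _ := by rw [f7, hinv]; field_simp; try ring

/-- Symmetry argument. -/
lemma depth_two_symm (a b : ℕ → ZMod p)
    (hab : ∀ k ∈ Finset.Icc 1 (p - 1), ∀ l ∈ Finset.Icc 1 (p - 1),
      a (p - k) * b (p - l) = a k * b l)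
    (h0 : (∑ k ∈ Finset.Icc 1 (p - 1), a k) * (∑ k ∈ Finset.Icc 1 (p - 1), b k) = 0) :
    2 * (∑ k ∈ Finset.Icc 1 (p - 1), a k * ∑ l ∈ Finset.Icc 1 (k - 1), b l) =
      - ∑ k ∈ Finset.Icc 1 (p - 1), a k * b k := by
  set I := Finset.Icc 1 (p - 1) with hI
  have l1 : ∑ k ∈ I, a k * ∑ l ∈ Finset.Icc 1 (k - 1), b l =
      ∑ k ∈ I, ∑ l ∈ I, if l < k then a k * b l else 0 := by
    refine Finset.sum_congr rfl fun k hk => ?_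
    rw [Finset.mul_sum, ← Finset.sum_filter]
    refine Finset.sum_congr ?_ fun _ _ => rfl
    ext l; simp [hI] at hk ⊢; omega
  have refl : ∀ g : ℕ → ZMod p, ∑ k ∈ I, g (p - k) = ∑ k ∈ I, g k := by
    intro g
    refine Finset.sum_bij (fun k _ => p - k) ?_ ?_ ?_ (fun _ _ => rfl)
    · intro k hk; simp [hI] at hk ⊢; omega
    · intro k hk l hl h; simp [hI] at hk hl h; try omega
    · intro k hk; simp [hI] at hk; exact ⟨p - k, by simp [hI]; omega, by omega⟩
  have l2 : ∑ k ∈ I, ∑ l ∈ I, (if l < k then a k * b l else 0) =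
      ∑ k ∈ I, ∑ l ∈ I, if k < l then a k * b l else 0 := by
    rw [← refl]
    refine Finset.sum_congr rfl fun k hk => ?_
    rw [← refl]
    refine Finset.sum_congr rfl fun l hl => ?_
    rw [hab k hk l hl]
    simp [hI] at hk hl
    have : p - l < p - k ↔ k < l := by omega
    simp only [this]
  have l3 : ∑ k ∈ I, a k * b k = ∑ k ∈ I, ∑ l ∈ I, if k = l then a k * b l else 0 := by
    refine Finset.sum_congr rfl fun k hk => ?_
    rw [Finset.sum_ite_eq, if_pos hk]
  rw [eq_neg_iff_add_eq_zero, ← h0, two_mul, l1]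
  nth_rewrite 2 [l2]
  rw [l3, Finset.sum_mul_sum, ← Finset.sum_add_distrib, ← Finset.sum_add_distrib]
  refine Finset.sum_congr rfl fun k hk => ?_
  rw [← Finset.sum_add_distrib, ← Finset.sum_add_distrib]
  refine Finset.sum_congr rfl fun l hl => ?_
  rcases lt_trichotomy k l with h | h | h
  · simp [h, h.ne, not_lt.2 h.le]
  · simp [h]
  · simp [h, h.ne', not_lt.2 h.le]

lemma reflect_term {e : ZMod p} (he : e = 1 ∨ e = -1) (hp : Odd p) {k s : ℕ}
    (hk : k ∈ Finset.Icc 1 (p - 1)) :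
    e ^ (p - k) / ((p - k : ℕ) : ZMod p) ^ s = e * (-1) ^ s * (e ^ k / (k : ZMod p) ^ s) := by
  simp at hk
  have h1 : ((p - k : ℕ) : ZMod p) = - (k : ZMod p) := by
    rw [Nat.cast_sub (by omega)]; simp
  have h3 : e ^ (p - k) = e * e ^ k := by
    rcases he with rfl | rfl
    · simp
    · rcases Nat.even_or_odd k with h | h
      · rw [h.neg_one_pow, (Nat.Odd.sub_even (by omega) hp h).neg_one_pow]; simp
      · rw [h.neg_one_pow, (Nat.Odd.sub_odd hp h).neg_one_pow]; simp
  have h4 : ((-1 : ZMod p) ^ s) * (-1) ^ s = 1 := by rw [← mul_pow]; simp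
  rw [h1, h3, neg_pow]
  have : ((-1 : ZMod p) ^ s)⁻¹ = (-1) ^ s := inv_eq_of_mul_eq_one_left h4
  rw [div_eq_mul_inv, mul_inv, this]; ring

/-- Combined statement for a pair of signs with product `-1`. -/
lemma main_pair {s t : ℕ} (hs : 0 < s) (ht : 0 < t) (hw : Odd (s + t)) (hwp : s + t + 3 ≤ p)
    {ε η : ℚ} {e f : ZMod p} (he : Red p ε e) (hf : Red p η f)
    (hef : (e = -1 ∧ f = 1) ∨ (e = 1 ∧ f = -1)) :
    RatModEq p 1 (AMHS (p - 1) [(s, ε), (t, η)])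
        ((1 - (2 : ℚ) ^ ((1 : ℤ) - ((s + t : ℕ) : ℤ))) *
          (bernoulli (p - (s + t)) / ((s + t : ℕ) : ℚ))) ∧
      RatModEq p 1 (-(AMHSstar (p - 1) [(s, ε), (t, η)]))
        ((1 - (2 : ℚ) ^ ((1 : ℤ) - ((s + t : ℕ) : ℤ))) *
          (bernoulli (p - (s + t)) / ((s + t : ℕ) : ℚ))) := by
  have hpp := (Fact.out : p.Prime)
  have hodd : Odd p := hpp.odd_of_ne_two (by omega)
  have hw3 : 3 ≤ s + t := by
    rcases hw with ⟨q, hq⟩; omega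
  have h2 : (2 : ZMod p) ≠ 0 := by
    simpa using natCast_ne_zero_of_lt (p := p) (k := 2) (by omega) (by omega)
  have hwne : ((s + t : ℕ) : ZMod p) ≠ 0 := natCast_ne_zero_of_lt (by omega) (by omega)
  obtain ⟨β, hβ⟩ := red_bernoulli (p := p) (p - (s + t)) (by omega)
  have hd := alt_diag hw3 hwp hβ
  have hprod : e * f = -1 := by rcases hef with ⟨rfl, rfl⟩ | ⟨rfl, rfl⟩ <;> simp
  have he1 : e = 1 ∨ e = -1 := by tauto
  have hf1 : f = 1 ∨ f = -1 := by tauto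
  have hsym := depth_two_symm (p := p) (fun k => e ^ k / (k : ZMod p) ^ s)
    (fun k => f ^ k / (k : ZMod p) ^ t) (by
      intro k hk l hl
      rw [reflect_term he1 hodd hk, reflect_term hf1 hodd hl]
      have : e * (-1) ^ s * (f * (-1) ^ t) = 1 := by
        calc e * (-1) ^ s * (f * (-1) ^ t) = (e * f) * (-1) ^ (s + t) := by ring
          _ = 1 := by rw [hprod, hw.neg_one_pow]; simp
      linear_combination (e ^ k / (k : ZMod p) ^ s) * (f ^ l / (l : ZMod p) ^ t) * this) (by
      rcases hef with ⟨rfl, rfl⟩ | ⟨rfl, rfl⟩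
      · rw [sum_inv_pow ht (by omega), mul_zero]
      · rw [sum_inv_pow hs (by omega), zero_mul])
  have hdiag : ∑ k ∈ Finset.Icc 1 (p - 1), (e ^ k / (k : ZMod p) ^ s) *
      (f ^ k / (k : ZMod p) ^ t) =
      ∑ k ∈ Finset.Icc 1 (p - 1), (-1 : ZMod p) ^ k / (k : ZMod p) ^ (s + t) := by
    refine Finset.sum_congr rfl fun k _ => ?_
    rw [div_mul_div_comm, ← mul_pow, hprod, pow_add]
  rw [hdiag] at hsym
  set D := ∑ k ∈ Finset.Icc 1 (p - 1), (-1 : ZMod p) ^ k / (k : ZMod p) ^ (s + t) with hD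
  have hR : Red p ((1 - (2 : ℚ) ^ ((1 : ℤ) - ((s + t : ℕ) : ℤ))) *
          (bernoulli (p - (s + t)) / ((s + t : ℕ) : ℚ)))
          ((1 - 2 / 2 ^ (s + t)) * (β / ((s + t : ℕ) : ZMod p))) := by
    rw [zpow_sub₀ (by norm_num), zpow_one, zpow_natCast]
    exact (red_one.sub (red_two.div (red_two.pow _) (pow_ne_zero _ h2))).mul
      (hβ.div (red_nat _) hwne)
  have hRD : (1 - 2 / 2 ^ (s + t)) * (β / ((s + t : ℕ) : ZMod p)) = - D / 2 := by
    rw [← mul_div_assoc, div_eq_div_iff hwne h2]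
    linear_combination hd
  rw [hRD] at hR
  have hA := red_AMHS2 (p := p) (n := p - 1) (s := s) (t := t) (by omega) he hf
  have hB := red_AMHSstar2 (p := p) (n := p - 1) (s := s) (t := t) (by omega) he hf
  set A := ∑ k ∈ Finset.Icc 1 (p - 1), e ^ k / (k : ZMod p) ^ s *
      ∑ l ∈ Finset.Icc 1 (k - 1), f ^ l / (l : ZMod p) ^ t with hAdef
  have hBA : ∑ k ∈ Finset.Icc 1 (p - 1), e ^ k / (k : ZMod p) ^ s *
      ∑ l ∈ Finset.Icc 1 k, f ^ l / (l : ZMod p) ^ t = A + D := by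
    rw [hAdef, ← hdiag, ← Finset.sum_add_distrib]
    refine Finset.sum_congr rfl fun k hk => ?_
    rw [Finset.mem_Icc] at hk
    obtain ⟨j, rfl⟩ : ∃ j, k = j + 1 := ⟨k - 1, by omega⟩
    rw [Finset.sum_Icc_succ_top (by omega), Nat.add_sub_cancel, mul_add]
  have hAD : A = - D / 2 := by
    rw [eq_div_iff h2]; linear_combination hsym
  constructor
  · rw [hAD] at hA
    exact hA.modEq hR
  · rw [hBA] at hB
    have hB' := hB.neg
    have : -(A + D) = - D / 2 := by
      rw [hAD]; field_simp; try ring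
    rw [this] at hB'
    exact hB'.modEq hR

end red

/-- Theorem `thm:FMZVdepth2superbity1`, second part.
For positive integers `s, t` with `w = s + t` odd and all sufficiently large primes `p`:
`H_{p-1}(s̄,t) ≡ H_{p-1}(s,t̄) ≡ -H⋆_{p-1}(s̄,t) ≡ -H⋆_{p-1}(s,t̄)
  ≡ (1 - 2^{1-w}) B_{p-w}/w (mod p)`. -/
theorem depth_two_fes (s t : ℕ) (hs : 0 < s) (ht : 0 < t) (hw : Odd (s + t)) :
    ∃ N, ∀ p ≥ N, Nat.Prime p →
      RatModEq p 1 (AMHS (p - 1) [(s, (-1 : ℚ)), (t, (1 : ℚ))])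
        ((1 - (2 : ℚ) ^ ((1 : ℤ) - ((s + t : ℕ) : ℤ))) *
          (bernoulli (p - (s + t)) / ((s + t : ℕ) : ℚ))) ∧
      RatModEq p 1 (AMHS (p - 1) [(s, (1 : ℚ)), (t, (-1 : ℚ))])
        ((1 - (2 : ℚ) ^ ((1 : ℤ) - ((s + t : ℕ) : ℤ))) *
          (bernoulli (p - (s + t)) / ((s + t : ℕ) : ℚ))) ∧
      RatModEq p 1 (-(AMHSstar (p - 1) [(s, (-1 : ℚ)), (t, (1 : ℚ))]))
        ((1 - (2 : ℚ) ^ ((1 : ℤ) - ((s + t : ℕ) : ℤ))) *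
          (bernoulli (p - (s + t)) / ((s + t : ℕ) : ℚ))) ∧
      RatModEq p 1 (-(AMHSstar (p - 1) [(s, (1 : ℚ)), (t, (-1 : ℚ))]))
        ((1 - (2 : ℚ) ^ ((1 : ℤ) - ((s + t : ℕ) : ℤ))) *
          (bernoulli (p - (s + t)) / ((s + t : ℕ) : ℚ))) := by
  refine ⟨s + t + 3, fun p hp hpp => ?_⟩
  have : Fact p.Prime := ⟨hpp⟩
  have hm : Red p (-1 : ℚ) (-1 : ZMod p) := red_one.neg
  obtain ⟨h1, h2⟩ := main_pair hs ht hw hp hm (red_one (p := p)) (Or.inl ⟨rfl, rfl⟩)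
  obtain ⟨h3, h4⟩ := main_pair hs ht hw hp (red_one (p := p)) hm (Or.inr ⟨rfl, rfl⟩)
  exact ⟨h1, h3, h2, h4⟩
end
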